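/- Suppose Condition (C) holds, a+b=1, and there exists N₀ > 0 such that ρ_k is nondecreasing in k for k ≥ N₀. If Σ_{n=2}^∞ 1/(D_X(n) log n) < ∞, then almost surely the chain X has at most finitely many cutpoints. If instead there exists δ > 0 such that D_X(n) ≤ δ·n·log n for all sufficiently large n and Σ_{n=2}^∞ 1/(D_X(n) log n) = ∞, then almost surely X has infinitely many cutpoints. -/

import Mathlib

open Filter MeasureTheory ENNReal Topology

noncomputable section

/-- Transition function of the (2,1) random walk `X`: from `0` jump to `1`, from `1`
jump to `2`, and from `n ≥ 2` jump to `n+1`, `n-1`, `n-2` with probabilities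
`q n`, `p1 n`, `p2 n` respectively. -/
def transX (q p1 p2 : ℕ → ℝ) (n j : ℕ) : ℝ :=
  if n = 0 then (if j = 1 then 1 else 0)
  else if n = 1 then (if j = 2 then 1 else 0)
  else if j = n + 1 then q n
  else if j = n - 1 then p1 n
  else if j = n - 2 then p2 n
  else 0

/-- `μ` is the law (on path space) of the time-homogeneous Markov chain on `ℕ`
with one-step transition probabilities `p` and initial state `init`. -/
def IsMarkovChain (μ : Measure (ℕ → ℕ)) (p : ℕ → ℕ → ℝ) (init : ℕ) : Prop :=
  μ {ω | ω 0 = init} = 1 ∧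
  ∀ (k : ℕ) (x : ℕ → ℕ) (j : ℕ),
    μ {ω | (∀ i ≤ k, ω i = x i) ∧ ω (k + 1) = j}
      = ENNReal.ofReal (p (x k) j) * μ {ω | ∀ i ≤ k, ω i = x i}

/-- `ρ_k`, the spectral radius of the matrix `A_k`. -/
def rho (q p1 p2 : ℕ → ℝ) (k : ℕ) : ℝ :=
  ((p1 k + p2 k) / q k
    + Real.sqrt (((p1 k + p2 k) / q k) ^ 2 + 4 * (p2 k / q k))) / 2

/-- `D_X(n) = 1 + Σ_{j=n+1}^∞ Π_{i=n+1}^j ρ_i`, valued in `ℝ≥0∞`. -/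
def DX (q p1 p2 : ℕ → ℝ) (n : ℕ) : ℝ≥0∞ :=
  1 + ∑' j : ℕ, ENNReal.ofReal (∏ i ∈ Finset.Icc (n + 1) (n + 1 + j), rho q p1 p2 i)


section Aux
/-! ### Path functionals -/

/-- Running maximum of a path. -/
def runMax (ω : ℕ → ℕ) : ℕ → ℕ
  | 0 => ω 0
  | n + 1 => max (runMax ω n) (ω (n + 1))

/-- While the running maximum equals `i`, the path stays at or above `j`. -/
def GG (i j : ℕ) : Set (ℕ → ℕ) := {ω | ∀ n, runMax ω n = i → j ≤ ω n}

lemma runMax_congr {ω ω' : ℕ → ℕ} (n : ℕ) (h : ∀ i ≤ n, ω i = ω' i) :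
    runMax ω n = runMax ω' n := by
  induction n with
  | zero => simpa [runMax] using h 0 le_rfl
  | succ n ih =>
    simp only [runMax]
    rw [ih (fun i hi => h i (by omega)), h (n + 1) le_rfl]

lemma le_runMax (ω : ℕ → ℕ) {m n : ℕ} (h : m ≤ n) : ω m ≤ runMax ω n := by
  induction n with
  | zero =>
    obtain rfl : m = 0 := by omega
    simp [runMax]
  | succ n ih =>
    simp only [runMax]
    rcases Nat.lt_or_ge n m with h1 | h1
    · obtain rfl : m = n + 1 := by omega
      exact le_max_right _ _
    · exact (ih h1).trans (le_max_left _ _)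

lemma runMax_mono (ω : ℕ → ℕ) : Monotone (runMax ω) :=
  monotone_nat_of_le_succ (fun n => by simp [runMax])

lemma exists_eq_runMax (ω : ℕ → ℕ) (n : ℕ) : ∃ m ≤ n, ω m = runMax ω n := by
  induction n with
  | zero => exact ⟨0, le_rfl, rfl⟩
  | succ n ih =>
    obtain ⟨m, hm, h⟩ := ih
    simp only [runMax]
    rcases le_total (runMax ω n) (ω (n + 1)) with h1 | h1
    · exact ⟨n + 1, le_rfl, by rw [max_eq_right h1]⟩
    · exact ⟨m, by omega, by rw [max_eq_left h1, h]⟩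

lemma measurable_runMax (n : ℕ) : Measurable (fun ω : ℕ → ℕ => runMax ω n) := by
  induction n with
  | zero => exact measurable_pi_apply 0
  | succ n ih => exact ih.max (measurable_pi_apply (n + 1))

lemma measurableSet_GG (i j : ℕ) : MeasurableSet (GG i j) := by
  have : GG i j = ⋂ n, ({ω | runMax ω n = i}ᶜ ∪ {ω | j ≤ ω n}) := by
    ext ω; simp [GG, imp_iff_not_or]
  rw [this]
  refine MeasurableSet.iInter fun n => ?_
  refine MeasurableSet.union ?_ ?_
  · exact (measurable_runMax n (measurableSet_singleton i)).compl
  · exact measurable_pi_apply (X := fun _ : ℕ => ℕ) n (measurableSet_Ici (a := j))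

lemma GG_zero (i : ℕ) : GG i 0 = Set.univ := by ext; simp [GG]

lemma GG_anti (i : ℕ) {j j' : ℕ} (h : j ≤ j') : GG i j' ⊆ GG i j :=
  fun _ hω n hn => h.trans (hω n hn)

/-- Threshold used by the cutpoint event of `k` at level `i`. -/
def thr (k i : ℕ) : ℕ := if i = k then k else k + 1

/-- The event that the walk, between the first visits to `j` and `k`, stays above `j`. -/
def AA (j k : ℕ) : Set (ℕ → ℕ) := {ω | ∀ i, j ≤ i → i < k → ω ∈ GG i (thr j i)}

/-- The event that `k` is a (strong) cutpoint. -/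
def CC (k : ℕ) : Set (ℕ → ℕ) := {ω | ∀ i, k ≤ i → ω ∈ GG i (thr k i)}

/-- Regular paths. -/
def Good (ω : ℕ → ℕ) : Prop :=
  ω 0 = 2 ∧ (∀ n, ω (n + 1) ≤ ω n + 1 ∧ ω (n + 1) ≠ ω n) ∧ ∀ M, ∃ n, M < runMax ω n

lemma hit_between {ω : ℕ → ℕ} (h : ∀ n, ω (n + 1) ≤ ω n + 1) {k m n : ℕ} (hmn : m ≤ n)
    (hm : ω m ≤ k) (hn : k ≤ ω n) : ∃ l, m ≤ l ∧ l ≤ n ∧ ω l = k := by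
  induction n, hmn using Nat.le_induction with
  | base => exact ⟨m, le_rfl, le_rfl, by omega⟩
  | succ n hmn ih =>
    rcases Nat.lt_or_ge (ω n) k with h1 | h1
    · exact ⟨n + 1, by omega, le_rfl, by have := h n; omega⟩
    · obtain ⟨l, h2, h3, h4⟩ := ih h1
      exact ⟨l, h2, by omega, h4⟩

lemma cut_of_CC {ω : ℕ → ℕ} (hω : Good ω) {k : ℕ} (hk : 2 ≤ k) (hC : ω ∈ CC k) :
    ∃! n, ω n = k := by
  obtain ⟨h0, h1, h2⟩ := hω
  have hsf : ∀ n, ω (n + 1) ≤ ω n + 1 := fun n => (h1 n).1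
  obtain ⟨N, hN⟩ := h2 k
  obtain ⟨m, hm, hmN⟩ := exists_eq_runMax ω N
  have hex : ∃ n, ω n = k := by
    obtain ⟨l, _, _, hl⟩ := hit_between hsf (Nat.zero_le m) (k := k) (by omega) (by omega)
    exact ⟨l, hl⟩
  -- any visit happens while the running maximum is `k`
  have key : ∀ n, ω n = k → runMax ω n = k := by
    intro n hn
    by_contra hne
    have h3 : k ≤ runMax ω n := hn ▸ le_runMax ω le_rfl
    have h4 := hC (runMax ω n) h3 n rfl
    simp only [thr, hne, if_false] at h4
    omega
  have key2 : ∀ m n, m < n → ω m = k → ω n = k → False := by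
    intro m n hmn hm hn
    have e1 := key m hm
    have e2 := key n hn
    have e3 : runMax ω (m + 1) = k := by
      have i1 := runMax_mono ω (show m ≤ m + 1 by omega)
      have i2 := runMax_mono ω (show m + 1 ≤ n by omega)
      omega
    have h4 := hC k le_rfl (m + 1) e3
    simp only [thr, if_true] at h4
    have h5 := le_runMax ω (le_refl (m + 1))
    have h6 := (h1 m).2
    omega
  obtain ⟨n, hn⟩ := hex
  refine ⟨n, hn, fun n' hn' => ?_⟩
  rcases lt_trichotomy n n' with h | h | h
  · exact (key2 _ _ h hn hn').elim
  · exact h.symm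
  · exact (key2 _ _ h hn' hn).elim

lemma CC_of_cut {ω : ℕ → ℕ} (hω : Good ω) {k : ℕ} (hk : 2 ≤ k) (hC : ∃! n, ω n = k) :
    ω ∈ CC k := by
  obtain ⟨h0, h1, h2⟩ := hω
  have hsf : ∀ n, ω (n + 1) ≤ ω n + 1 := fun n => (h1 n).1
  obtain ⟨n0, hn0, huniq⟩ := hC
  simp only at hn0 huniq
  intro i hi n hn
  -- level `k` was visited before or at time `n`
  obtain ⟨m, hm, hmn⟩ := exists_eq_runMax ω n
  obtain ⟨l, _, hl1, hl2⟩ := hit_between hsf (Nat.zero_le m) (k := k) (by omega) (by omega)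
  have hl := huniq l hl2
  by_contra hlt
  push Not at hlt
  have hle : ω n ≤ k := by
    unfold thr at hlt; split_ifs at hlt <;> omega
  obtain ⟨N, hN⟩ := h2 (runMax ω n)
  obtain ⟨M, hM, hMN⟩ := exists_eq_runMax ω N
  have hMn : n < M := by
    by_contra hc
    have := le_runMax ω (show M ≤ n by omega)
    omega
  obtain ⟨l', hl'1, _, hl'2⟩ := hit_between hsf hMn.le hle (by omega)
  have hl' := huniq l' hl'2
  have : n = n0 := by omega
  have hmn0 : m = n0 ∨ m < n0 := by omega
  have hik : i = k := by
    rcases hmn0 with h | h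
    · rw [h] at hmn; omega
    · omega
  unfold thr at hlt
  rw [if_pos hik] at hlt
  rw [this] at hlt
  omega

lemma CC_eq (k : ℕ) : CC k = ⋂ n, AA k n := by
  ext ω
  simp only [CC, AA, Set.mem_ofPred_eq, Set.mem_iInter]
  exact ⟨fun h n i hi _ => h i hi, fun h i hi => h (i + 1) i hi (by omega)⟩

lemma AA_anti (k : ℕ) : Antitone (AA k) := fun _ _ h _ hω i hi hik => hω i hi (by omega)

lemma measurableSet_AA (j k : ℕ) : MeasurableSet (AA j k) := by
  have : AA j k = ⋂ i, ⋂ (_ : j ≤ i), ⋂ (_ : i < k), GG i (thr j i) := by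
    ext ω; simp [AA]
  rw [this]
  exact MeasurableSet.iInter fun i => MeasurableSet.iInter fun _ => MeasurableSet.iInter fun _ =>
    measurableSet_GG _ _

lemma measurableSet_CC (k : ℕ) : MeasurableSet (CC k) := by
  rw [CC_eq]; exact MeasurableSet.iInter fun n => measurableSet_AA k n

lemma CC_inter {j k : ℕ} (hjk : j < k) : CC j ∩ CC k = AA j k ∩ CC k := by
  ext ω
  constructor
  · rintro ⟨h1, h2⟩
    exact ⟨fun i hi _ => h1 i hi, h2⟩
  · rintro ⟨h1, h2⟩
    refine ⟨fun i hi => ?_, h2⟩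
    rcases Nat.lt_or_ge i k with h | h
    · exact h1 i hi h
    · refine GG_anti i ?_ (h2 i h)
      unfold thr; split_ifs <;> omega

/-! ### Markov property on cylinders -/

lemma lintegral_cyl (ν : Measure (ℕ → ℕ)) (n : ℕ) (Ψ : (ℕ → ℕ) → ℝ≥0∞)
    (hΨ : ∀ ω ω', (∀ i ≤ n, ω i = ω' i) → Ψ ω = Ψ ω') :
    ∫⁻ ω, Ψ ω ∂ν = ∑' x : Fin (n + 1) → ℕ,
      Ψ (fun i => if h : i < n + 1 then x ⟨i, h⟩ else 0) *
        ν {ω | ∀ i ≤ n, ω i = (fun i => if h : i < n + 1 then x ⟨i, h⟩ else 0) i} := by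
  have hm : Measurable (fun (ω : ℕ → ℕ) (i : Fin (n + 1)) => ω i) := by fun_prop
  have h1 : ∫⁻ ω, Ψ ω ∂ν = ∫⁻ x, Ψ (fun i => if h : i < n + 1 then x ⟨i, h⟩ else 0)
      ∂(ν.map (fun (ω : ℕ → ℕ) (i : Fin (n + 1)) => ω i)) := by
    rw [lintegral_map (measurable_of_countable _) hm]
    refine lintegral_congr fun ω => hΨ _ _ fun i hi => ?_
    simp [show i < n + 1 by omega]
  rw [h1, lintegral_countable']
  refine tsum_congr fun x => ?_
  congr 1
  rw [Measure.map_apply hm (measurableSet_singleton x)]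
  congr 1
  ext ω
  simp only [Set.mem_preimage, Set.mem_singleton_iff, Set.mem_ofPred_eq]
  constructor
  · rintro rfl i hi
    simp [show i < n + 1 by omega]
  · intro h
    funext i
    have := h i (by omega)
    simpa [show (i : ℕ) ≤ n by omega] using this

lemma one_step {μ : Measure (ℕ → ℕ)} {p : ℕ → ℕ → ℝ} {init : ℕ}
    (hμ : IsMarkovChain μ p init) (n : ℕ) (Φ : (ℕ → ℕ) → ℝ≥0∞)
    (hΦ : ∀ ω ω', (∀ i ≤ n + 1, ω i = ω' i) → Φ ω = Φ ω') :
    ∫⁻ ω, Φ ω ∂μ =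
      ∫⁻ ω, ∑' y, ENNReal.ofReal (p (ω n) y) * Φ (Function.update ω (n + 1) y) ∂μ := by
  have hdep : ∀ y ω ω', (∀ i ≤ n, ω i = ω' i) →
      Φ (Function.update ω (n + 1) y) = Φ (Function.update ω' (n + 1) y) := by
    intro y ω ω' h
    apply hΦ
    intro i hi
    rcases eq_or_ne i (n + 1) with rfl | hne
    · simp
    · rw [Function.update_of_ne hne, Function.update_of_ne hne, h i (by omega)]
  have hmeas : ∀ (m : ℕ) (Ψ : (ℕ → ℕ) → ℝ≥0∞),
      (∀ ω ω', (∀ i ≤ m, ω i = ω' i) → Ψ ω = Ψ ω') → Measurable Ψ := by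
    intro m Ψ hΨ
    have hm : Measurable (fun (ω : ℕ → ℕ) (i : Fin (m + 1)) => ω i) := by fun_prop
    have : Ψ = (fun x : Fin (m + 1) → ℕ =>
        Ψ (fun i => if h : i < m + 1 then x ⟨i, h⟩ else 0)) ∘
        (fun (ω : ℕ → ℕ) (i : Fin (m + 1)) => ω i) := by
      funext ω
      refine hΨ _ _ fun i hi => ?_
      simp [show i < m + 1 by omega]
    rw [this]
    exact (measurable_of_countable _).comp hm
  have hset : ∀ y : ℕ, MeasurableSet {ω : ℕ → ℕ | ω (n + 1) = y} := fun y =>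
    measurable_pi_apply (X := fun _ : ℕ => ℕ) (n + 1) (measurableSet_singleton y)
  rw [lintegral_tsum]
  swap
  · intro y
    refine (hmeas n _ ?_).aemeasurable
    intro ω ω' h
    rw [hdep y ω ω' h, h n le_rfl]
  have h1 : ∫⁻ ω, Φ ω ∂μ = ∑' y, ∫⁻ ω in {ω : ℕ → ℕ | ω (n + 1) = y}, Φ ω ∂μ := by
    rw [← lintegral_iUnion hset]
    · have : (⋃ y : ℕ, {ω : ℕ → ℕ | ω (n + 1) = y}) = Set.univ := by ext; simp
      rw [this, Measure.restrict_univ]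
    · intro y y' hne
      rw [Function.onFun, Set.disjoint_left]
      intro ω h h'
      exact hne (h.symm.trans h')
  rw [h1]
  refine tsum_congr fun y => ?_
  have h2 : ∫⁻ ω in {ω : ℕ → ℕ | ω (n + 1) = y}, Φ ω ∂μ
      = ∫⁻ ω in {ω : ℕ → ℕ | ω (n + 1) = y}, Φ (Function.update ω (n + 1) y) ∂μ := by
    refine setLIntegral_congr_fun (hset y) fun ω hω => ?_
    have hω' : ω (n + 1) = y := hω
    rw [← hω', Function.update_eq_self]
  rw [h2, lintegral_cyl _ n _ (hdep y), lintegral_cyl μ n]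
  · refine tsum_congr fun x => ?_
    rw [Measure.restrict_apply' (hset y)]
    have h3 := hμ.2 n (fun i => if h : i < n + 1 then x ⟨i, h⟩ else 0) y
    have h4 : {ω : ℕ → ℕ | ∀ i ≤ n, ω i = (fun i => if h : i < n + 1 then x ⟨i, h⟩ else 0) i} ∩
        {ω | ω (n + 1) = y} = {ω | (∀ i ≤ n, ω i = (fun i => if h : i < n + 1 then x ⟨i, h⟩ else 0) i)
          ∧ ω (n + 1) = y} := rfl
    rw [h4, h3]
    ring
  · intro ω ω' h
    rw [hdep y ω ω' h, h n le_rfl]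

/-! ### The concrete chain -/

/-- Basic positivity hypotheses. -/
structure Hyp (q p1 p2 : ℕ → ℝ) : Prop where
  hq : ∀ k, 2 ≤ k → 0 < q k
  hp1 : ∀ k, 2 ≤ k → 0 ≤ p1 k
  hp2 : ∀ k, 2 ≤ k → 0 < p2 k
  hsum : ∀ k, 2 ≤ k → q k + p1 k + p2 k = 1

lemma tsum_trans_ge {q p1 p2 : ℕ → ℝ} {x : ℕ} (hx : 2 ≤ x) (g : ℕ → ℝ≥0∞) :
    ∑' y, ENNReal.ofReal (transX q p1 p2 x y) * g y =
      ENNReal.ofReal (q x) * g (x + 1) + ENNReal.ofReal (p1 x) * g (x - 1)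
        + ENNReal.ofReal (p2 x) * g (x - 2) := by
  rw [tsum_eq_sum (s := {x + 1, x - 1, x - 2})]
  · rw [Finset.sum_insert, Finset.sum_insert, Finset.sum_singleton]
    · have e1 : transX q p1 p2 x (x + 1) = q x := by
        simp [transX, show x ≠ 0 by omega, show x ≠ 1 by omega]
      have e2 : transX q p1 p2 x (x - 1) = p1 x := by
        simp [transX, show x ≠ 0 by omega, show x ≠ 1 by omega, show x - 1 ≠ x + 1 by omega]
      have e3 : transX q p1 p2 x (x - 2) = p2 x := by
        simp [transX, show x ≠ 0 by omega, show x ≠ 1 by omega, show x - 2 ≠ x + 1 by omega,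
          show x - 2 ≠ x - 1 by omega]
      rw [e1, e2, e3, add_assoc]
    · simp; omega
    · simp; omega
  · intro y hy
    simp only [Finset.mem_insert, Finset.mem_singleton, not_or] at hy
    simp [transX, show x ≠ 0 by omega, show x ≠ 1 by omega, hy.1, hy.2.1, hy.2.2]

lemma tsum_trans_lt {q p1 p2 : ℕ → ℝ} {x : ℕ} (hx : x < 2) (g : ℕ → ℝ≥0∞) :
    ∑' y, ENNReal.ofReal (transX q p1 p2 x y) * g y = g (x + 1) := by
  rw [tsum_eq_single (x + 1)]
  · interval_cases x <;> simp [transX]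
  · intro y hy
    interval_cases x
    · simp [transX, show y ≠ 1 by omega]
    · simp [transX, show y ≠ 2 by omega]

lemma ae_init {q p1 p2 : ℕ → ℝ} {μ : Measure (ℕ → ℕ)} [IsProbabilityMeasure μ]
    (hμ : IsMarkovChain μ (transX q p1 p2) 2) : ∀ᵐ ω ∂μ, ω 0 = 2 := by
  have hm : MeasurableSet {ω : ℕ → ℕ | ω 0 = 2} :=
    measurable_pi_apply (X := fun _ : ℕ => ℕ) 0 (measurableSet_singleton 2)
  exact (prob_compl_eq_zero_iff hm).2 hμ.1

lemma ae_step {q p1 p2 : ℕ → ℝ} {μ : Measure (ℕ → ℕ)}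
    (hμ : IsMarkovChain μ (transX q p1 p2) 2) :
    ∀ᵐ ω ∂μ, ∀ n, ω (n + 1) ≤ ω n + 1 ∧ ω (n + 1) ≠ ω n := by
  rw [ae_all_iff]
  intro n
  classical
  have h := one_step hμ n (fun ω => if ω (n + 1) ≤ ω n + 1 ∧ ω (n + 1) ≠ ω n then 0 else 1)
    (fun ω ω' h => by simp only [h n (by omega), h (n + 1) le_rfl])
  have h0 : ∀ ω : ℕ → ℕ, ∑' y, ENNReal.ofReal (transX q p1 p2 (ω n) y) *
      (if (Function.update ω (n + 1) y) (n + 1) ≤ (Function.update ω (n + 1) y) n + 1 ∧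
        (Function.update ω (n + 1) y) (n + 1) ≠ (Function.update ω (n + 1) y) n
        then 0 else 1) = 0 := by
    intro ω
    simp only [Function.update_self, Function.update_of_ne (show n ≠ n + 1 by omega)]
    rcases Nat.lt_or_ge (ω n) 2 with hx | hx
    · rw [tsum_trans_lt hx (fun y => if y ≤ ω n + 1 ∧ y ≠ ω n then 0 else 1)]
      simp
    · rw [tsum_trans_ge hx (fun y => if y ≤ ω n + 1 ∧ y ≠ ω n then 0 else 1)]
      simp [show ω n - 1 ≤ ω n + 1 by omega, show ω n - 2 ≤ ω n + 1 by omega,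
        show ω n - 1 ≠ ω n by omega, show ω n - 2 ≠ ω n by omega]
  simp only [h0, lintegral_zero] at h
  have hm : Measurable (fun ω : ℕ → ℕ => if ω (n + 1) ≤ ω n + 1 ∧ ω (n + 1) ≠ ω n
      then (0 : ℝ≥0∞) else 1) := by
    have : (fun ω : ℕ → ℕ => if ω (n + 1) ≤ ω n + 1 ∧ ω (n + 1) ≠ ω n
      then (0 : ℝ≥0∞) else 1) =
      (fun z : ℕ × ℕ => if z.2 ≤ z.1 + 1 ∧ z.2 ≠ z.1 then (0 : ℝ≥0∞) else 1) ∘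
        (fun ω => (ω n, ω (n + 1))) := rfl
    rw [this]
    exact (measurable_of_countable _).comp (by fun_prop)
  rw [lintegral_eq_zero_iff hm] at h
  filter_upwards [h] with ω hω
  by_contra hc
  simp [hc] at hω

lemma lyap {q p1 p2 : ℕ → ℝ} (hy : Hyp q p1 p2) (M : ℕ) : ∃ (V : ℕ → ℝ) (θ : ℝ), 0 ≤ θ ∧ θ < 1 ∧ (∀ x ≤ M + 1, 1 ≤ V x) ∧
    (∀ x ≤ M, 2 ≤ x → q x * V (x + 1) + p1 x * V (x - 1) + p2 x * V (x - 2) ≤ θ * V x) ∧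
    (∀ x ≤ M, x < 2 → V (x + 1) ≤ θ * V x) := by
  obtain ⟨l, hl2, hl⟩ : ∃ l : ℝ, 2 ≤ l ∧ ∀ x ≤ M, 2 ≤ x → 2 ≤ q x * l := by
    induction M with
    | zero => exact ⟨2, le_rfl, fun x hx hx2 => by omega⟩
    | succ M ih =>
      obtain ⟨l, hl2, hl⟩ := ih
      by_cases hM : 2 ≤ M + 1
      · refine ⟨max l (2 / q (M + 1)), le_max_of_le_left hl2, fun x hx hx2 => ?_⟩
        have hqx := hy.hq x hx2
        rcases Nat.lt_or_ge M x with h | h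
        · obtain rfl : x = M + 1 := by omega
          calc (2 : ℝ) = q (M + 1) * (2 / q (M + 1)) := by field_simp
            _ ≤ _ := by gcongr; exact le_max_right _ _
        · refine (hl x h hx2).trans ?_
          gcongr; exact le_max_left _ _
      · exact ⟨l, hl2, fun x hx hx2 => by omega⟩
  set c : ℝ := l ^ (M + 1) + 1 with hc
  have hl1 : (1 : ℝ) ≤ l := by linarith
  have hpos : ∀ n : ℕ, (1 : ℝ) ≤ l ^ n := fun n => one_le_pow₀ hl1
  have hc1 : 2 ≤ c := by have := hpos (M + 1); linarith
  have hθ : ∀ x, (1 - 1 / c) * (c - l ^ x) ≥ c - l ^ x - 1 := by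
    intro x
    have : (1 - 1 / c) * (c - l ^ x) = c - l ^ x - 1 + l ^ x / c := by field_simp; ring
    rw [this]
    have : 0 ≤ l ^ x / c := by have := hpos x; positivity
    linarith
  refine ⟨fun x => c - l ^ x, 1 - 1 / c, ?_, ?_, ?_, ?_, ?_⟩
  · have : 1 / c ≤ 1 := by rw [div_le_one (by linarith)]; linarith
    linarith
  · have : 0 < 1 / c := by positivity
    linarith
  · intro x hx
    have : l ^ x ≤ l ^ (M + 1) := pow_le_pow_right₀ hl1 hx
    simp only; linarith
  · intro x hx hx2
    refine le_trans ?_ (hθ x)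
    have h1 := hl x hx hx2
    have h2 := hy.hp1 x hx2
    have h3 := (hy.hp2 x hx2).le
    have h4 := hy.hsum x hx2
    have h5 := hpos x
    have h6 := hpos (x - 1)
    have h7 := hpos (x - 2)
    have h8 : q x * l ^ (x + 1) ≥ 2 * l ^ x := by
      rw [pow_succ]; nlinarith
    have h9 : q x * c + p1 x * c + p2 x * c = c := by rw [← add_mul, ← add_mul, h4, one_mul]
    have h10 : 0 ≤ p1 x * l ^ (x - 1) := by positivity
    have h11 : 0 ≤ p2 x * l ^ (x - 2) := by positivity
    simp only [mul_sub]
    linarith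
  · intro x hx hx2
    refine le_trans ?_ (hθ x)
    have h5 := hpos x
    have : l ^ (x + 1) ≥ 2 * l ^ x := by rw [pow_succ]; nlinarith
    simp only
    linarith

lemma ae_unbounded {q p1 p2 : ℕ → ℝ} (hy : Hyp q p1 p2) {μ : Measure (ℕ → ℕ)} [IsProbabilityMeasure μ]
    (hμ : IsMarkovChain μ (transX q p1 p2) 2) : ∀ᵐ ω ∂μ, ∀ M, ∃ n, M < runMax ω n := by
  rw [ae_all_iff]
  intro M
  classical
  obtain ⟨V, θ, hθ0, hθ1, hV1, hV2, hV3⟩ := lyap hy M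
  set I : ℕ → ℝ≥0∞ := fun n => ∫⁻ ω, (if runMax ω n ≤ M then ENNReal.ofReal (V (ω n)) else 0) ∂μ
    with hI
  have hstep : ∀ n, I (n + 1) ≤ ENNReal.ofReal θ * I n := by
    intro n
    simp only [hI]
    rw [one_step hμ n _ (fun ω ω' h => by rw [runMax_congr (n + 1) h, h (n + 1) le_rfl]),
      ← lintegral_const_mul' _ _ ENNReal.ofReal_ne_top]
    refine lintegral_mono fun ω => ?_
    have e1 : ∀ y, runMax (Function.update ω (n + 1) y) (n + 1) = max (runMax ω n) y := by
      intro y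
      simp only [runMax, Function.update_self]
      congr 1
      exact runMax_congr n fun i hi => Function.update_of_ne (by omega) _ _
    simp only [e1, Function.update_self]
    by_cases hM : runMax ω n ≤ M
    · rw [if_pos hM]
      have hx : ω n ≤ M := (le_runMax ω le_rfl).trans hM
      have hle : ∀ y, (if max (runMax ω n) y ≤ M then ENNReal.ofReal (V y) else 0)
          ≤ ENNReal.ofReal (V y) := by intro y; split_ifs <;> simp
      refine (ENNReal.tsum_le_tsum fun y => mul_le_mul_right (hle y) _).trans ?_
      rw [← ENNReal.ofReal_mul hθ0]
      rcases Nat.lt_or_ge (ω n) 2 with h2 | h2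
      · rw [tsum_trans_lt h2 (fun y => ENNReal.ofReal (V y))]
        exact ENNReal.ofReal_le_ofReal (hV3 _ hx h2)
      · rw [tsum_trans_ge h2 (fun y => ENNReal.ofReal (V y))]
        have a1 := (hy.hq _ h2).le
        have a2 := hy.hp1 _ h2
        have a3 := (hy.hp2 _ h2).le
        have b1 := zero_le_one.trans (hV1 (ω n + 1) (by omega))
        have b2 := zero_le_one.trans (hV1 (ω n - 1) (by omega))
        have b3 := zero_le_one.trans (hV1 (ω n - 2) (by omega))
        rw [← ENNReal.ofReal_mul a1, ← ENNReal.ofReal_mul a2, ← ENNReal.ofReal_mul a3,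
          ← ENNReal.ofReal_add (by positivity) (by positivity),
          ← ENNReal.ofReal_add (by positivity) (by positivity)]
        exact ENNReal.ofReal_le_ofReal (hV2 _ hx h2)
    · rw [if_neg hM]
      have : ∀ y, ¬ (max (runMax ω n) y ≤ M) := fun y h => hM ((le_max_left _ _).trans h)
      simp [this]
  have hI0 : I 0 ≠ ⊤ := by
    have : I 0 ≤ ENNReal.ofReal (V 2) := by
      simp only [hI]
      calc _ ≤ ∫⁻ ω, ENNReal.ofReal (V 2) ∂μ := by
            refine lintegral_mono_ae ?_
            filter_upwards [ae_init hμ] with ω hω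
            rw [hω]; split_ifs <;> simp
        _ = _ := by simp
    exact ne_top_of_le_ne_top ENNReal.ofReal_ne_top this
  have hIn : ∀ n, I n ≤ ENNReal.ofReal θ ^ n * I 0 := by
    intro n
    induction n with
    | zero => simp
    | succ n ih =>
      refine (hstep n).trans ?_
      rw [pow_succ', mul_assoc]
      gcongr
  have hlim : Tendsto (fun n => ENNReal.ofReal θ ^ n * I 0) atTop (𝓝 0) := by
    have := ENNReal.Tendsto.mul_const (b := I 0) (ENNReal.tendsto_pow_atTop_nhds_zero_of_lt_one
      (r := ENNReal.ofReal θ) (by simpa using hθ1)) (Or.inr hI0)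
    simpa using this
  have hmeas : ∀ n, μ {ω | ¬ ∃ n, M < runMax ω n} ≤ I n := by
    intro n
    have hms : MeasurableSet {ω : ℕ → ℕ | ¬ ∃ n, M < runMax ω n} := by
      have : {ω : ℕ → ℕ | ¬ ∃ n, M < runMax ω n} = ⋂ n, {ω | runMax ω n ≤ M} := by
        ext ω; simp
      rw [this]
      exact MeasurableSet.iInter fun n => measurable_runMax n (measurableSet_Iic (a := M))
    rw [← lintegral_indicator_one hms]
    refine lintegral_mono fun ω => ?_
    by_cases hω : ω ∈ {ω : ℕ → ℕ | ¬ ∃ n, M < runMax ω n}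
    · rw [Set.indicator_of_mem hω]
      have h1 : runMax ω n ≤ M := by
        by_contra hc
        exact hω ⟨n, by omega⟩
      simp only [h1, if_true, Pi.one_apply]
      rw [← ENNReal.ofReal_one]
      exact ENNReal.ofReal_le_ofReal
        (hV1 _ (((le_runMax ω le_rfl).trans h1).trans (by omega)))
    · rw [Set.indicator_of_notMem hω]
      exact bot_le
  have : μ {ω | ¬ ∃ n, M < runMax ω n} ≤ 0 :=
    ge_of_tendsto' hlim fun n => (hmeas n).trans (hIn n)
  exact le_antisymm this bot_le


lemma ae_good {q p1 p2 : ℕ → ℝ} (hy : Hyp q p1 p2) {μ : Measure (ℕ → ℕ)} [IsProbabilityMeasure μ]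
    (hμ : IsMarkovChain μ (transX q p1 p2) 2) : ∀ᵐ ω ∂μ, Good ω := by
  filter_upwards [ae_init hμ, ae_step hμ, ae_unbounded hy hμ] with ω h1 h2 h3
  exact ⟨h1, h2, h3⟩

/-! ### Harmonic functions -/

/-- The function that vanishes below `j`, equals `1` at `j` and is harmonic from `j` on. -/
def harm (q p1 p2 : ℕ → ℝ) (j : ℕ) : ℕ → ℝ
  | 0 => if j = 0 then 1 else 0
  | 1 => if j ≤ 1 then 1 else 0
  | 2 => if j ≤ 2 then 1 else 0
  | (x + 3) => if x + 3 < j then 0 else if x + 3 = j then 1 else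
      harm q p1 p2 j (x + 2)
        + (p1 (x + 2) + p2 (x + 2)) / q (x + 2) *
          (harm q p1 p2 j (x + 2) - harm q p1 p2 j (x + 1))
        + p2 (x + 2) / q (x + 2) * (harm q p1 p2 j (x + 1) - harm q p1 p2 j x)

lemma harm_lt (q p1 p2 : ℕ → ℝ) {j x : ℕ} (h : x < j) : harm q p1 p2 j x = 0 := by
  match x with
  | 0 => simp [harm]; omega
  | 1 => simp [harm]; omega
  | 2 => simp [harm]; omega
  | (x + 3) => rw [harm, if_pos h]

lemma harm_self (q p1 p2 : ℕ → ℝ) (j : ℕ) : harm q p1 p2 j j = 1 := by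
  match j with
  | 0 => simp [harm]
  | 1 => simp [harm]
  | 2 => simp [harm]
  | (x + 3) => rw [harm, if_neg (by omega), if_pos rfl]

lemma harm_small (q p1 p2 : ℕ → ℝ) {j x : ℕ} (hx : x < 2) (h : j ≤ x) :
    harm q p1 p2 j (x + 1) = harm q p1 p2 j x := by
  interval_cases x
  · simp [harm, show j = 0 by omega]
  · simp [harm, show j ≤ 1 by omega, show j ≤ 2 by omega]

lemma harm_rec (q p1 p2 : ℕ → ℝ) {j x : ℕ} (hx : 2 ≤ x) (h : j ≤ x) :
    harm q p1 p2 j (x + 1) = harm q p1 p2 j x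
      + (p1 x + p2 x) / q x * (harm q p1 p2 j x - harm q p1 p2 j (x - 1))
      + p2 x / q x * (harm q p1 p2 j (x - 1) - harm q p1 p2 j (x - 2)) := by
  obtain ⟨x, rfl⟩ : ∃ z, x = z + 2 := ⟨x - 2, by omega⟩
  rw [harm, if_neg (by omega), if_neg (by omega)]
  simp

lemma harm_mono {q p1 p2 : ℕ → ℝ} (hy : Hyp q p1 p2) (j : ℕ) : Monotone (harm q p1 p2 j) := by
  refine monotone_nat_of_le_succ fun x => ?_
  induction x using Nat.strong_induction_on with
  | _ x ih =>
    rcases lt_trichotomy (x + 1) j with h | h | h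
    · rw [harm_lt _ _ _ h, harm_lt _ _ _ (by omega)]
    · rw [harm_lt _ _ _ (show x < j by omega), h, harm_self]; exact zero_le_one
    · rcases Nat.lt_or_ge x 2 with h2 | h2
      · rw [harm_small _ _ _ h2 (by omega)]
      · rw [harm_rec _ _ _ h2 (by omega)]
        have i1 := ih (x - 1) (by omega)
        have i2 := ih (x - 2) (by omega)
        rw [show x - 1 + 1 = x by omega] at i1
        rw [show x - 2 + 1 = x - 1 by omega] at i2
        have a1 := (hy.hq _ h2)
        have a2 := hy.hp1 _ h2
        have a3 := (hy.hp2 _ h2).le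
        have b1 : 0 ≤ (p1 x + p2 x) / q x *
            (harm q p1 p2 j x - harm q p1 p2 j (x - 1)) :=
          mul_nonneg (by positivity) (by linarith)
        have b2 : 0 ≤ p2 x / q x * (harm q p1 p2 j (x - 1) - harm q p1 p2 j (x - 2)) :=
          mul_nonneg (by positivity) (by linarith)
        linarith

lemma harm_nonneg {q p1 p2 : ℕ → ℝ} (hy : Hyp q p1 p2) (j x : ℕ) : 0 ≤ harm q p1 p2 j x := by
  refine le_trans ?_ (harm_mono hy j (Nat.zero_le x))
  simp only [harm]; split_ifs <;> norm_num

lemma harm_pos {q p1 p2 : ℕ → ℝ} (hy : Hyp q p1 p2) {j x : ℕ} (h : j ≤ x) :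
    0 < harm q p1 p2 j x := by
  have := harm_mono hy j h
  rw [harm_self] at this
  linarith

lemma harm_harmonic {q p1 p2 : ℕ → ℝ} (hy : Hyp q p1 p2) {j x : ℕ} (hx : 2 ≤ x) (h : j ≤ x) :
    q x * harm q p1 p2 j (x + 1) + p1 x * harm q p1 p2 j (x - 1) + p2 x * harm q p1 p2 j (x - 2)
      = harm q p1 p2 j x := by
  rw [harm_rec _ _ _ hx h]
  have a1 := (hy.hq _ hx).ne'
  have a2 : q x = 1 - p1 x - p2 x := by linarith [hy.hsum x hx]
  field_simp
  rw [a2]; ring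

/-- Probability that the excursion at level `i` stays above `j`. -/
def rr (q p1 p2 : ℕ → ℝ) (i j : ℕ) : ℝ :=
  if i < 2 then 1 else harm q p1 p2 j i / harm q p1 p2 j (i + 1)

lemma rr_nonneg {q p1 p2 : ℕ → ℝ} (hy : Hyp q p1 p2) (i j : ℕ) : 0 ≤ rr q p1 p2 i j := by
  unfold rr; split_ifs
  · norm_num
  · exact div_nonneg (harm_nonneg hy _ _) (harm_nonneg hy _ _)

lemma rr_le_one {q p1 p2 : ℕ → ℝ} (hy : Hyp q p1 p2) (i j : ℕ) : rr q p1 p2 i j ≤ 1 := by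
  unfold rr; split_ifs
  · norm_num
  · exact div_le_one_of_le₀ (harm_mono hy j (by omega)) (harm_nonneg hy _ _)

lemma harm_zero {q p1 p2 : ℕ → ℝ} (x : ℕ) : harm q p1 p2 0 x = 1 := by
  induction x using Nat.strong_induction_on with
  | _ x ih =>
    match x with
    | 0 => simp [harm]
    | 1 => simp [harm]
    | 2 => simp [harm]
    | (x + 3) =>
      rw [harm, if_neg (by omega), if_neg (by omega), ih (x + 2) (by omega), ih (x + 1) (by omega),
        ih x (by omega)]
      ring

lemma rr_zero {q p1 p2 : ℕ → ℝ} (i : ℕ) : rr q p1 p2 i 0 = 1 := by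
  simp [rr, harm_zero]

/-- Weight of the product martingale. -/
def wt (q p1 p2 : ℕ → ℝ) (J : ℕ → ℕ) (K x s : ℕ) : ℝ :=
  if K < s then 1 else harm q p1 p2 (J s) x / harm q p1 p2 (J s) (s + 1) *
    ∏ i ∈ Finset.Ioc s K, rr q p1 p2 i (J i)

lemma wt_nonneg {q p1 p2 : ℕ → ℝ} (hy : Hyp q p1 p2) (J : ℕ → ℕ) (K x s : ℕ) :
    0 ≤ wt q p1 p2 J K x s := by
  unfold wt; split_ifs
  · norm_num
  · exact mul_nonneg (div_nonneg (harm_nonneg hy _ _) (harm_nonneg hy _ _))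
      (Finset.prod_nonneg fun i _ => rr_nonneg hy _ _)

lemma wt_le_one {q p1 p2 : ℕ → ℝ} (hy : Hyp q p1 p2) (J : ℕ → ℕ) (K : ℕ) {x s : ℕ} (h : x ≤ s) :
    wt q p1 p2 J K x s ≤ 1 := by
  unfold wt; split_ifs
  · norm_num
  · refine mul_le_one₀ (div_le_one_of_le₀ (harm_mono hy _ (by omega)) (harm_nonneg hy _ _))
      (Finset.prod_nonneg fun i _ => rr_nonneg hy _ _)
      (Finset.prod_le_one (fun i _ => rr_nonneg hy _ _) (fun i _ => rr_le_one hy _ _))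

/-- The path has respected the thresholds up to time `n`. -/
def alive (J : ℕ → ℕ) (K : ℕ) (ω : ℕ → ℕ) (n : ℕ) : Prop :=
  ∀ m ≤ n, runMax ω m ≤ K → J (runMax ω m) ≤ ω m

lemma alive_congr (J : ℕ → ℕ) (K : ℕ) {ω ω' : ℕ → ℕ} {n : ℕ} (h : ∀ i ≤ n, ω i = ω' i) :
    alive J K ω n ↔ alive J K ω' n := by
  unfold alive
  refine forall₂_congr fun m hm => ?_
  rw [runMax_congr m fun i hi => h i (hi.trans hm), h m hm]

open Classical in
/-- The product martingale. -/
def WW (q p1 p2 : ℕ → ℝ) (J : ℕ → ℕ) (K n : ℕ) (ω : ℕ → ℕ) : ℝ≥0∞ :=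
  if alive J K ω n then ENNReal.ofReal (wt q p1 p2 J K (ω n) (runMax ω n)) else 0

lemma WW_congr (q p1 p2 : ℕ → ℝ) (J : ℕ → ℕ) (K n : ℕ) {ω ω' : ℕ → ℕ}
    (h : ∀ i ≤ n, ω i = ω' i) : WW q p1 p2 J K n ω = WW q p1 p2 J K n ω' := by
  classical
  unfold WW
  rw [runMax_congr n h, h n le_rfl]
  simp only [alive_congr J K h]

lemma wt_step {q p1 p2 : ℕ → ℝ} (hy : Hyp q p1 p2) (J : ℕ → ℕ) {K y s : ℕ} (hs2 : 2 ≤ s)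
    (hs : s ≤ K) (hJ : J s ≤ s) (hy' : y ≤ s + 1) :
    wt q p1 p2 J K y (max s y) = harm q p1 p2 (J s) y / harm q p1 p2 (J s) (s + 1) *
      ∏ i ∈ Finset.Ioc s K, rr q p1 p2 i (J i) := by
  rcases Nat.lt_or_ge s y with h | h
  · obtain rfl : y = s + 1 := by omega
    have hpos := harm_pos hy (show J s ≤ s + 1 by omega)
    rw [max_eq_right (by omega), div_self hpos.ne', one_mul]
    unfold wt
    split_ifs with h1
    · rw [Finset.Ioc_eq_empty (by omega), Finset.prod_empty]
    · have : Finset.Ioc s K = insert (s + 1) (Finset.Ioc (s + 1) K) := by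
        ext i; simp; omega
      rw [this, Finset.prod_insert (by simp), rr, if_neg (by omega)]
  · rw [max_eq_left h, wt, if_neg (by omega)]

lemma WW_step {q p1 p2 : ℕ → ℝ} (hy : Hyp q p1 p2) (J : ℕ → ℕ) (K n : ℕ) (ω : ℕ → ℕ)
    (h0 : ω 0 = 2) :
    ∑' y, ENNReal.ofReal (transX q p1 p2 (ω n) y) *
      WW q p1 p2 J K (n + 1) (Function.update ω (n + 1) y) = WW q p1 p2 J K n ω := by
  classical
  set s := runMax ω n with hs
  have hxs : ω n ≤ s := le_runMax ω le_rfl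
  have hs2 : 2 ≤ s := by rw [← h0]; exact le_runMax ω (Nat.zero_le n)
  have e0 : ∀ y, ∀ i ≤ n, Function.update ω (n + 1) y i = ω i :=
    fun y i hi => Function.update_of_ne (by omega) _ _
  have e1 : ∀ y, runMax (Function.update ω (n + 1) y) (n + 1) = max s y := by
    intro y
    simp only [runMax, Function.update_self]
    congr 1
    exact runMax_congr n (e0 y)
  have e2 : ∀ y, alive J K (Function.update ω (n + 1) y) (n + 1) ↔
      alive J K ω n ∧ (max s y ≤ K → J (max s y) ≤ y) := by
    intro y
    rw [← alive_congr J K (e0 y)]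
    constructor
    · intro h
      refine ⟨fun m hm => h m (by omega), ?_⟩
      have := h (n + 1) le_rfl
      rw [e1] at this
      simpa using this
    · rintro ⟨h1, h2⟩ m hm
      rcases Nat.lt_or_ge n m with h | h
      · obtain rfl : m = n + 1 := by omega
        rw [e1]
        simpa using h2
      · exact h1 m h
  have e3 : ∀ y, WW q p1 p2 J K (n + 1) (Function.update ω (n + 1) y) =
      if alive J K ω n then ENNReal.ofReal (wt q p1 p2 J K y (max s y)) else 0 := by
    intro y
    unfold WW
    rw [e1, Function.update_self]
    by_cases hA : alive J K ω n
    · by_cases hB : max s y ≤ K → J (max s y) ≤ y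
      · rw [if_pos ((e2 y).2 ⟨hA, hB⟩), if_pos hA]
      · rw [if_neg (fun h => hB ((e2 y).1 h).2), if_pos hA]
        push Not at hB
        rw [wt, if_neg (by omega), harm_lt _ _ _ hB.2]
        simp
    · rw [if_neg (fun h => hA ((e2 y).1 h).1), if_neg hA]
  simp only [e3]
  unfold WW
  by_cases hA : alive J K ω n
  · simp only [if_pos hA]
    rw [← hs]
    rcases Nat.lt_or_ge K s with hK | hK
    · have e4 : ∀ y, wt q p1 p2 J K y (max s y) = 1 := by
        intro y; rw [wt, if_pos (lt_of_lt_of_le hK (le_max_left _ _))]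
      simp only [e4]
      rw [wt, if_pos hK]
      rcases Nat.lt_or_ge (ω n) 2 with h2 | h2
      · rw [tsum_trans_lt h2 (fun _ => ENNReal.ofReal 1)]
      · rw [tsum_trans_ge h2 (fun _ => ENNReal.ofReal 1)]
        have a1 := (hy.hq _ h2).le
        have a2 := hy.hp1 _ h2
        have a3 := (hy.hp2 _ h2).le
        rw [← add_mul, ← add_mul, ← ENNReal.ofReal_add (by positivity) (by positivity),
          ← ENNReal.ofReal_add (by positivity) (by positivity), hy.hsum _ h2]
        simp
    · have hJx : J s ≤ ω n := hA n le_rfl hK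
      have e4 : ∀ y ≤ s + 1, wt q p1 p2 J K y (max s y) =
          harm q p1 p2 (J s) y / harm q p1 p2 (J s) (s + 1) *
          ∏ i ∈ Finset.Ioc s K, rr q p1 p2 i (J i) := fun y hy' =>
        wt_step hy J hs2 hK (hJx.trans hxs) hy'
      have e5 := e4 (ω n) (by omega)
      rw [max_eq_left hxs] at e5
      rcases Nat.lt_or_ge (ω n) 2 with h2 | h2
      · rw [tsum_trans_lt h2 (fun y => ENNReal.ofReal (wt q p1 p2 J K y (max s y))),
          e4 _ (by omega), e5, harm_small _ _ _ h2 hJx]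
      · rw [tsum_trans_ge h2 (fun y => ENNReal.ofReal (wt q p1 p2 J K y (max s y)))]
        have a1 := (hy.hq _ h2).le
        have a2 := hy.hp1 _ h2
        have a3 := (hy.hp2 _ h2).le
        have c : ∀ y, 0 ≤ wt q p1 p2 J K y (max s y) := fun y => wt_nonneg hy _ _ _ _
        rw [← ENNReal.ofReal_mul a1, ← ENNReal.ofReal_mul a2, ← ENNReal.ofReal_mul a3,
          ← ENNReal.ofReal_add (mul_nonneg a1 (c _)) (mul_nonneg a2 (c _)),
          ← ENNReal.ofReal_add (add_nonneg (mul_nonneg a1 (c _)) (mul_nonneg a2 (c _)))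
            (mul_nonneg a3 (c _))]
        congr 1
        rw [e4 _ (by omega), e4 _ (by omega), e4 _ (by omega), e5, ← harm_harmonic hy h2 hJx]
        ring
  · simp only [if_neg hA]
    simp

lemma prod_formula {q p1 p2 : ℕ → ℝ} (hy : Hyp q p1 p2) {μ : Measure (ℕ → ℕ)}
    [IsProbabilityMeasure μ] (hμ : IsMarkovChain μ (transX q p1 p2) 2) (J : ℕ → ℕ) {K : ℕ}
    (hK : 2 ≤ K) :
    μ {ω | ∀ i ≤ K, ω ∈ GG i (J i)} =
      ENNReal.ofReal (∏ i ∈ Finset.range (K + 1), rr q p1 p2 i (if i < 2 then 0 else J i)) := by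
  classical
  have hconst : ∀ n, ∫⁻ ω, WW q p1 p2 J K n ω ∂μ = ∫⁻ ω, WW q p1 p2 J K 0 ω ∂μ := by
    intro n
    induction n with
    | zero => rfl
    | succ n ih =>
      rw [← ih, one_step hμ n _ (fun ω ω' h => WW_congr q p1 p2 J K (n + 1) h)]
      refine lintegral_congr_ae ?_
      filter_upwards [ae_init hμ] with ω hω
      exact WW_step hy J K n ω hω
  have h0 : ∫⁻ ω, WW q p1 p2 J K 0 ω ∂μ =
      ENNReal.ofReal (∏ i ∈ Finset.range (K + 1), rr q p1 p2 i (if i < 2 then 0 else J i)) := by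
    have : ∀ᵐ ω ∂μ, WW q p1 p2 J K 0 ω = ENNReal.ofReal
        (∏ i ∈ Finset.range (K + 1), rr q p1 p2 i (if i < 2 then 0 else J i)) := by
      filter_upwards [ae_init hμ] with ω hω
      have hr : ∏ i ∈ Finset.range (K + 1), rr q p1 p2 i (if i < 2 then 0 else J i) =
          harm q p1 p2 (J 2) 2 / harm q p1 p2 (J 2) 3 *
            ∏ i ∈ Finset.Ioc 2 K, rr q p1 p2 i (J i) := by
        have : Finset.range (K + 1) = insert 0 (insert 1 (insert 2 (Finset.Ioc 2 K))) := by
          ext i; simp; omega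
        rw [this, Finset.prod_insert (by simp), Finset.prod_insert (by simp),
          Finset.prod_insert (by simp)]
        have : ∏ i ∈ Finset.Ioc 2 K, rr q p1 p2 i (if i < 2 then 0 else J i) =
            ∏ i ∈ Finset.Ioc 2 K, rr q p1 p2 i (J i) := by
          refine Finset.prod_congr rfl fun i hi => ?_
          simp only [Finset.mem_Ioc] at hi
          rw [if_neg (by omega)]
        rw [this]
        simp [rr]
      have hr0 : runMax ω 0 = 2 := hω
      rw [hr, WW, hr0, hω, wt, if_neg (show ¬ K < 2 by omega)]
      split_ifs with hA
      · rfl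
      · have : 2 < J 2 := by
          by_contra hc
          apply hA
          intro m hm _
          obtain rfl : m = 0 := by omega
          rw [hr0, hω]; omega
        rw [harm_lt _ _ _ this]
        simp
    rw [lintegral_congr_ae this]
    simp
  have hmW : ∀ n, Measurable (WW q p1 p2 J K n) := by
    intro n
    have hm : Measurable (fun (ω : ℕ → ℕ) (i : Fin (n + 1)) => ω i) := by fun_prop
    have : WW q p1 p2 J K n = (fun x : Fin (n + 1) → ℕ =>
        WW q p1 p2 J K n (fun i => if h : i < n + 1 then x ⟨i, h⟩ else 0)) ∘
        (fun (ω : ℕ → ℕ) (i : Fin (n + 1)) => ω i) := by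
      funext ω
      refine WW_congr _ _ _ _ _ _ fun i hi => ?_
      simp [show i < n + 1 by omega]
    rw [this]
    exact (measurable_of_countable _).comp hm
  have hms : MeasurableSet {ω | ∀ i ≤ K, ω ∈ GG i (J i)} := by
    have : {ω | ∀ i ≤ K, ω ∈ GG i (J i)} = ⋂ i, ⋂ (_ : i ≤ K), GG i (J i) := by ext; simp
    rw [this]
    exact MeasurableSet.iInter fun i => MeasurableSet.iInter fun _ => measurableSet_GG _ _
  have hlim : Tendsto (fun n => ∫⁻ ω, WW q p1 p2 J K n ω ∂μ) atTop
      (𝓝 (∫⁻ ω, Set.indicator {ω | ∀ i ≤ K, ω ∈ GG i (J i)} 1 ω ∂μ)) := by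
    refine tendsto_lintegral_of_dominated_convergence (fun _ => 1) hmW ?_ (by simp) ?_
    · intro n
      refine Eventually.of_forall fun ω => ?_
      unfold WW
      split_ifs
      · rw [← ENNReal.ofReal_one]
        exact ENNReal.ofReal_le_ofReal (wt_le_one hy J K (le_runMax ω le_rfl))
      · exact bot_le
    · filter_upwards [ae_unbounded hy hμ] with ω hω
      obtain ⟨N, hN⟩ := hω K
      refine tendsto_const_nhds.congr' ?_
      filter_upwards [eventually_ge_atTop N] with n hn
      have hKn : ∀ m, n ≤ m → K < runMax ω m := fun m hm =>
        lt_of_lt_of_le hN (runMax_mono ω (hn.trans hm))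
      have hiff : alive J K ω n ↔ ∀ i ≤ K, ω ∈ GG i (J i) := by
        constructor
        · intro hA i hi m hm
          rcases Nat.lt_or_ge m n with h | h
          · have := hA m h.le (by omega)
            rwa [hm] at this
          · have := hKn m h
            omega
        · intro hA m _ hmK
          exact hA _ hmK m rfl
      unfold WW
      rw [wt, if_pos (hKn n le_rfl)]
      by_cases h : alive J K ω n
      · rw [if_pos h, Set.indicator_of_mem (show ω ∈ {ω | ∀ i ≤ K, ω ∈ GG i (J i)} from hiff.1 h)]
        simp
      · rw [if_neg h, Set.indicator_of_notMem
          (show ω ∉ {ω | ∀ i ≤ K, ω ∈ GG i (J i)} from fun h' => h (hiff.2 h'))]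
  simp only [hconst] at hlim
  have := tendsto_nhds_unique hlim tendsto_const_nhds
  rw [lintegral_indicator_one hms] at this
  rw [this, h0]

/-! ### Independence of the excursions -/

lemma measure_GG {q p1 p2 : ℕ → ℝ} (hy : Hyp q p1 p2) {μ : Measure (ℕ → ℕ)}
    [IsProbabilityMeasure μ] (hμ : IsMarkovChain μ (transX q p1 p2) 2) (i j : ℕ) :
    μ (GG i j) = ENNReal.ofReal (rr q p1 p2 i j) := by
  have h := prod_formula hy hμ (fun i' => if i' = i then j else 0) (K := max i 2) (le_max_right _ _)
  have e1 : {ω | ∀ i' ≤ max i 2, ω ∈ GG i' (if i' = i then j else 0)} = GG i j := by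
    ext ω
    constructor
    · intro h
      have := h i (le_max_left _ _)
      simpa using this
    · intro h i' _
      rcases eq_or_ne i' i with rfl | hne
      · simpa using h
      · simp [hne, GG_zero]
  rw [e1] at h
  rw [h]
  congr 1
  rw [Finset.prod_eq_single_of_mem i]
  · by_cases h2 : i < 2
    · simp [rr, h2]
    · simp [h2]
  · simp
  · intro b _ hb
    simp [hb, rr_zero]

/-- The sigma-algebra generated by the excursion at level `i`. -/
def msp (i : ℕ) : MeasurableSpace (ℕ → ℕ) := MeasurableSpace.generateFrom (Set.range (GG i))

lemma msp_le (i : ℕ) : msp i ≤ MeasurableSpace.pi := by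
  refine MeasurableSpace.generateFrom_le ?_
  rintro _ ⟨j, rfl⟩
  exact measurableSet_GG i j

lemma iIndep_msp {q p1 p2 : ℕ → ℝ} (hy : Hyp q p1 p2) {μ : Measure (ℕ → ℕ)}
    [IsProbabilityMeasure μ] (hμ : IsMarkovChain μ (transX q p1 p2) 2) :
    ProbabilityTheory.iIndep msp μ := by
  classical
  refine ProbabilityTheory.iIndepSets.iIndep msp_le (fun i => Set.range (GG i)) ?_ (fun i => rfl) ?_
  · rintro i _ ⟨j, rfl⟩ _ ⟨j', rfl⟩ _
    refine ⟨max j j', ?_⟩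
    ext ω
    constructor
    · intro h
      exact ⟨GG_anti i (le_max_left _ _) h, GG_anti i (le_max_right _ _) h⟩
    · rintro ⟨h1, h2⟩ n hn
      exact max_le (h1 n hn) (h2 n hn)
  · rw [ProbabilityTheory.iIndepSets_iff]
    intro s f hf
    have hf' : ∀ i, ∃ j, i ∈ s → GG i j = f i := by
      intro i
      by_cases hi : i ∈ s
      · obtain ⟨j, hj⟩ := hf i hi
        exact ⟨j, fun _ => hj⟩
      · exact ⟨0, fun h => (hi h).elim⟩
    choose J0 hJ0 using hf'
    set J : ℕ → ℕ := fun i => if i ∈ s then J0 i else 0 with hJ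
    set K := max (s.sup id) 2 with hK
    have hsK : ∀ i ∈ s, i ≤ K := fun i hi =>
      (Finset.le_sup (f := id) hi).trans (le_max_left _ _)
    have e1 : (⋂ i ∈ s, f i) = {ω | ∀ i ≤ K, ω ∈ GG i (J i)} := by
      ext ω
      simp only [Set.mem_iInter, Set.mem_ofPred_eq]
      constructor
      · intro h i _
        by_cases hi : i ∈ s
        · simp only [hJ, if_pos hi, hJ0 i hi]; exact h i hi
        · simp [hJ, if_neg hi, GG_zero]
      · intro h i hi
        have := h i (hsK i hi)
        simpa only [hJ, if_pos hi, hJ0 i hi] using this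
    rw [e1, prod_formula hy hμ J (le_max_right _ _)]
    have e2 : ∀ i, rr q p1 p2 i (if i < 2 then 0 else J i) = rr q p1 p2 i (J i) := by
      intro i
      by_cases h : i < 2 <;> simp [rr, h]
    simp only [e2]
    rw [ENNReal.ofReal_prod_of_nonneg (fun i _ => rr_nonneg hy _ _)]
    have hsub : s ⊆ Finset.range (K + 1) := fun i hi => by
      have := hsK i hi
      simp; omega
    rw [← Finset.prod_subset hsub]
    · refine Finset.prod_congr rfl fun i hi => ?_
      rw [← measure_GG hy hμ]
      simp only [hJ, if_pos hi, hJ0 i hi]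
    · intro i _ hi
      simp [hJ, if_neg hi, rr_zero]

/-- Past below level `k`. -/
def past (k : ℕ) : MeasurableSpace (ℕ → ℕ) := ⨆ i ∈ Set.Iio k, msp i

/-- Future from level `k` on. -/
def fut (k : ℕ) : MeasurableSpace (ℕ → ℕ) := ⨆ i ∈ Set.Ici k, msp i

lemma fut_le (k : ℕ) : fut k ≤ MeasurableSpace.pi := iSup₂_le fun i _ => msp_le i

lemma measurableSet_msp (i j : ℕ) : MeasurableSet[msp i] (GG i j) :=
  MeasurableSpace.measurableSet_generateFrom ⟨j, rfl⟩

lemma measurableSet_past {i k : ℕ} (h : i < k) (j : ℕ) : MeasurableSet[past k] (GG i j) :=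
  (le_iSup₂_of_le (f := fun i (_ : i ∈ Set.Iio k) => msp i) i h le_rfl) _ (measurableSet_msp i j)

lemma measurableSet_fut {i k : ℕ} (h : k ≤ i) (j : ℕ) : MeasurableSet[fut k] (GG i j) :=
  (le_iSup₂_of_le (f := fun i (_ : i ∈ Set.Ici k) => msp i) i h le_rfl) _ (measurableSet_msp i j)

lemma measurableSet_past_AA (j k : ℕ) : MeasurableSet[past k] (AA j k) := by
  have : AA j k = ⋂ i, ⋂ (_ : j ≤ i), ⋂ (_ : i < k), GG i (thr j i) := by
    ext ω; simp [AA]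
  rw [this]
  refine MeasurableSet.iInter fun i => MeasurableSet.iInter fun _ => MeasurableSet.iInter fun h =>
    measurableSet_past h _

lemma measurableSet_fut_CC {k l : ℕ} (h : k ≤ l) : MeasurableSet[fut k] (CC l) := by
  have : CC l = ⋂ i, ⋂ (_ : l ≤ i), GG i (thr l i) := by
    ext ω; simp [CC]
  rw [this]
  exact MeasurableSet.iInter fun i => MeasurableSet.iInter fun hi => measurableSet_fut (h.trans hi) _

lemma indep_AA {q p1 p2 : ℕ → ℝ} (hy : Hyp q p1 p2) {μ : Measure (ℕ → ℕ)}
    [IsProbabilityMeasure μ] (hμ : IsMarkovChain μ (transX q p1 p2) 2) (j k : ℕ)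
    {Y : Set (ℕ → ℕ)} (hY : MeasurableSet[fut k] Y) : μ (AA j k ∩ Y) = μ (AA j k) * μ Y := by
  have h := ProbabilityTheory.indep_iSup_of_disjoint msp_le (iIndep_msp hy hμ)
    (S := Set.Iio k) (T := Set.Ici k) (by
      rw [Set.disjoint_left]; intro x h1 h2; simp at h1 h2; omega)
  exact (ProbabilityTheory.Indep_iff _ _ _).1 h _ _ (measurableSet_past_AA j k) hY

lemma measure_AA {q p1 p2 : ℕ → ℝ} (hy : Hyp q p1 p2) {μ : Measure (ℕ → ℕ)}
    [IsProbabilityMeasure μ] (hμ : IsMarkovChain μ (transX q p1 p2) 2) {j k : ℕ} (hj : 2 ≤ j)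
    (hjk : j < k) : μ (AA j k) = ENNReal.ofReal (q j / harm q p1 p2 (j + 1) k) := by
  have hjk' : j + 1 ≤ k := hjk
  induction k, hjk' using Nat.le_induction with
  | base =>
    have : AA j (j + 1) = GG j j := by
      ext ω
      constructor
      · intro h
        have := h j le_rfl (by omega)
        simpa [thr] using this
      · intro h i h1 h2
        obtain rfl : i = j := by omega
        simpa [thr] using h
    rw [this, measure_GG hy hμ, harm_self, rr, if_neg (by omega), harm_self,
      harm_rec _ _ _ hj le_rfl, harm_self, harm_lt _ _ _ (show j - 1 < j by omega),
      harm_lt _ _ _ (show j - 2 < j by omega)]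
    congr 1
    have h1 := hy.hq j hj
    have h2 := hy.hsum j hj
    have h3 : 1 + (p1 j + p2 j) / q j * (1 - 0) + p2 j / q j * (0 - 0) = 1 / q j := by
      field_simp; linarith
    rw [h3]; simp
  | succ k hk ih =>
    have : AA j (k + 1) = AA j k ∩ GG k (j + 1) := by
      ext ω
      constructor
      · intro h
        refine ⟨fun i h1 h2 => h i h1 (by omega), ?_⟩
        have := h k (by omega) (by omega)
        simpa [thr, show k ≠ j by omega] using this
      · rintro ⟨h1, h2⟩ i h3 h4
        rcases Nat.lt_or_ge i k with h | h
        · exact h1 i h3 h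
        · obtain rfl : i = k := by omega
          simpa [thr, show i ≠ j by omega] using h2
    rw [this, indep_AA hy hμ j k (measurableSet_fut le_rfl _), ih hk, measure_GG hy hμ,
      ← ENNReal.ofReal_mul (div_nonneg (hy.hq j hj).le (harm_nonneg hy _ _)), rr,
      if_neg (by omega)]
    congr 1
    have h1 := (harm_pos hy (show j + 1 ≤ k by omega)).ne'
    field_simp

lemma tail_zero_one {q p1 p2 : ℕ → ℝ} (hy : Hyp q p1 p2) {μ : Measure (ℕ → ℕ)}
    [IsProbabilityMeasure μ] (hμ : IsMarkovChain μ (transX q p1 p2) 2) :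
    μ {ω | ∀ N, ∃ k ≥ N, ω ∈ CC k} = 0 ∨ μ {ω | ∀ N, ∃ k ≥ N, ω ∈ CC k} = 1 := by
  refine ProbabilityTheory.measure_zero_or_one_of_measurableSet_limsup_atTop msp_le
    (iIndep_msp hy hμ) ?_
  rw [Filter.limsup_eq_iInf_iSup_of_nat, MeasurableSpace.measurableSet_iInf]
  intro n
  have e : {ω | ∀ N, ∃ k ≥ N, ω ∈ CC k} = ⋂ N, ⋃ k, ⋃ (_ : max n N ≤ k), CC k := by
    ext ω
    simp only [Set.mem_ofPred_eq, Set.mem_iInter, Set.mem_iUnion]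
    constructor
    · intro h N
      obtain ⟨k, hk, hk'⟩ := h (max n N)
      exact ⟨k, hk, hk'⟩
    · intro h N
      obtain ⟨k, hk, hk'⟩ := h N
      exact ⟨k, (le_max_right _ _).trans hk, hk'⟩
  rw [e]
  refine MeasurableSet.iInter fun N => MeasurableSet.iUnion fun k => MeasurableSet.iUnion fun hk => ?_
  exact measurableSet_fut_CC (k := n) ((le_max_left _ _).trans hk)

lemma measure_CC_tendsto {μ : Measure (ℕ → ℕ)} [IsProbabilityMeasure μ] (k : ℕ) :
    Tendsto (fun n => μ (AA k n)) atTop (𝓝 (μ (CC k))) := by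
  rw [CC_eq]
  exact tendsto_measure_iInter_atTop (fun n => (measurableSet_AA k n).nullMeasurableSet)
    (AA_anti k) ⟨0, measure_ne_top _ _⟩

/-! ### Analytic estimates -/

/-- Products of the coefficients. -/
def pr (q p1 p2 : ℕ → ℝ) (k x : ℕ) : ℝ := ∏ i ∈ Finset.Ioc k x, rho q p1 p2 i

/-- Partial sums of `DX`. -/
def Dfin (q p1 p2 : ℕ → ℝ) (k x : ℕ) : ℝ := ∑ i ∈ Finset.Ico k x, pr q p1 p2 k i

lemma rho_pos {q p1 p2 : ℕ → ℝ} (hy : Hyp q p1 p2) {k : ℕ} (hk : 2 ≤ k) :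
    0 < rho q p1 p2 k := by
  have h1 := hy.hq k hk
  have h2 := hy.hp1 k hk
  have h3 := hy.hp2 k hk
  unfold rho
  positivity

lemma rho_sq {q p1 p2 : ℕ → ℝ} (hy : Hyp q p1 p2) {k : ℕ} (hk : 2 ≤ k) :
    rho q p1 p2 k ^ 2 = (p1 k + p2 k) / q k * rho q p1 p2 k + p2 k / q k := by
  have h1 := hy.hq k hk
  have h2 := hy.hp1 k hk
  have h3 := hy.hp2 k hk
  have hs := Real.sq_sqrt (show 0 ≤ ((p1 k + p2 k) / q k) ^ 2 + 4 * (p2 k / q k) by positivity)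
  unfold rho
  nlinarith

lemma A_le_rho {q p1 p2 : ℕ → ℝ} (hy : Hyp q p1 p2) {k : ℕ} (hk : 2 ≤ k) :
    (p1 k + p2 k) / q k ≤ rho q p1 p2 k := by
  have h0 := rho_pos hy hk
  have h1 := hy.hq k hk
  have h3 := hy.hp2 k hk
  have h4 := rho_sq hy hk
  have h5 : 0 < p2 k / q k := by positivity
  by_contra hc
  push Not at hc
  nlinarith

/-- Regularity of the coefficients from `K0` on. -/
structure Reg (q p1 p2 : ℕ → ℝ) (K0 : ℕ) (c : ℝ) : Prop where
  two : 2 ≤ K0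
  cpos : 0 < c
  cle : c ≤ 1
  lo : ∀ k, K0 ≤ k → 1 / 2 ≤ rho q p1 p2 k
  hi : ∀ k, K0 ≤ k → rho q p1 p2 k ≤ 1
  mono : ∀ k, K0 ≤ k → rho q p1 p2 k ≤ rho q p1 p2 (k + 1)
  ca : ∀ k, K0 ≤ k → c ≤ (p1 k + p2 k) / q k

lemma exists_reg {q p1 p2 : ℕ → ℝ} (a b : ℝ) (ha : 0 < a) (hb : 0 < b)
    (hCa : Tendsto (fun k => (p1 k + p2 k) / q k) atTop (𝓝 a))
    (hCb : Tendsto (fun k => p2 k / q k) atTop (𝓝 b))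
    (hab : a + b = 1) (N₀ : ℕ)
    (hmono : ∀ k l, N₀ ≤ k → k ≤ l → rho q p1 p2 k ≤ rho q p1 p2 l) :
    ∃ K0 c, Reg q p1 p2 K0 c := by
  have hlim : Tendsto (rho q p1 p2) atTop (𝓝 1) := by
    have h1 : Tendsto (rho q p1 p2) atTop (𝓝 ((a + Real.sqrt (a ^ 2 + 4 * b)) / 2)) := by
      unfold rho
      exact ((hCa.add (((hCa.pow 2).add (hCb.const_mul 4)).sqrt)).div_const 2)
    have h2 : Real.sqrt (a ^ 2 + 4 * b) = 2 - a := by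
      rw [show a ^ 2 + 4 * b = (2 - a) ^ 2 by
        rw [show b = 1 - a by linarith]; ring]
      exact Real.sqrt_sq (by linarith)
    rw [h2] at h1
    convert h1 using 2
    ring
  have e1 := hlim.eventually (lt_mem_nhds (show (1 / 2 : ℝ) < 1 by norm_num))
  have e2 := hCa.eventually (lt_mem_nhds (show a / 2 < a by linarith))
  obtain ⟨K1, hK1⟩ := eventually_atTop.1 (e1.and e2)
  refine ⟨max K1 (max N₀ 2), a / 2, ⟨?_, by linarith, by linarith, ?_, ?_, ?_, ?_⟩⟩
  · omega
  · intro k hk; exact (hK1 k (by omega)).1.le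
  · intro k hk
    refine ge_of_tendsto hlim ?_
    filter_upwards [eventually_ge_atTop k] with l hl
    exact hmono k l (by omega) hl
  · intro k hk; exact hmono k (k + 1) (by omega) (by omega)
  · intro k hk; exact (hK1 k (by omega)).2.le

section est
variable {q p1 p2 : ℕ → ℝ} {K0 : ℕ} {c : ℝ}

lemma pr_self (k : ℕ) : pr q p1 p2 k k = 1 := by simp [pr]

lemma pr_succ {k x : ℕ} (h : k ≤ x) :
    pr q p1 p2 k (x + 1) = pr q p1 p2 k x * rho q p1 p2 (x + 1) := by
  unfold pr
  have : Finset.Ioc k (x + 1) = insert (x + 1) (Finset.Ioc k x) := by ext i; simp; omega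
  rw [this, Finset.prod_insert (by simp), mul_comm]

lemma pr_pos (hy : Hyp q p1 p2) {k : ℕ} (hk : 2 ≤ k) (x : ℕ) : 0 < pr q p1 p2 k x := by
  refine Finset.prod_pos fun i hi => rho_pos hy ?_
  simp at hi; omega

lemma pr_le_one (hy : Hyp q p1 p2) (hr : Reg q p1 p2 K0 c) {k : ℕ} (hk : K0 ≤ k) (x : ℕ) :
    pr q p1 p2 k x ≤ 1 := by
  refine Finset.prod_le_one (fun i hi => (rho_pos hy ?_).le) (fun i hi => hr.hi i ?_)
  · simp at hi; have := hr.two; omega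
  · simp at hi; omega

lemma pr_mul {k x y : ℕ} (h1 : k ≤ x) (h2 : x ≤ y) :
    pr q p1 p2 k y = pr q p1 p2 k x * pr q p1 p2 x y := by
  unfold pr
  rw [Finset.prod_Ioc_consecutive _ h1 h2]

lemma pr_anti (hy : Hyp q p1 p2) (hr : Reg q p1 p2 K0 c) {k x y : ℕ} (hk : K0 ≤ k) (h1 : k ≤ x)
    (h2 : x ≤ y) : pr q p1 p2 k y ≤ pr q p1 p2 k x := by
  rw [pr_mul h1 h2]
  have := pr_le_one hy hr (hk.trans h1) y
  have h3 := pr_pos hy (hr.two.trans hk) x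
  nlinarith

lemma incr_bounds (hy : Hyp q p1 p2) (hr : Reg q p1 p2 K0 c) {k : ℕ} (hk : K0 ≤ k) (n : ℕ) :
    c * pr q p1 p2 k (k + n) ≤ harm q p1 p2 (k + 1) (k + n + 1) - harm q p1 p2 (k + 1) (k + n) ∧
    harm q p1 p2 (k + 1) (k + n + 1) - harm q p1 p2 (k + 1) (k + n) ≤
      pr q p1 p2 k (k + n) * Real.exp (8 * (rho q p1 p2 (k + n) - rho q p1 p2 k)) := by
  have h2 := hr.two
  induction n using Nat.twoStepInduction with
  | zero =>
    rw [Nat.add_zero, pr_self, harm_self, harm_lt _ _ _ (show k < k + 1 by omega)]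
    simpa using hr.cle
  | one =>
    rw [pr_succ le_rfl, pr_self, harm_rec _ _ _ (show 2 ≤ k + 1 by omega) le_rfl, harm_self,
      harm_lt _ _ _ (show k + 1 - 1 < k + 1 by omega), harm_lt _ _ _ (show k + 1 - 2 < k + 1 by omega)]
    have i1 := A_le_rho hy (show 2 ≤ k + 1 by omega)
    have i2 := hr.ca (k + 1) (by omega)
    have i3 := hr.hi (k + 1) (by omega)
    have i4 := hr.cpos
    have i5 := hr.lo (k + 1) (by omega)
    have i6 := hr.mono k hk
    have i7 : 1 ≤ Real.exp (8 * (rho q p1 p2 (k + 1) - rho q p1 p2 k)) :=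
      Real.one_le_exp (by linarith)
    constructor
    · nlinarith
    · nlinarith
  | more n ih1 ih2 =>
    obtain ⟨l1, u1⟩ := ih1
    obtain ⟨l2, u2⟩ := ih2
    rw [show k + (n + 1) = k + n + 1 by ring] at l2 u2
    rw [show k + (n + 2) = k + n + 1 + 1 by ring]
    have hrec := harm_rec q p1 p2 (j := k + 1) (show 2 ≤ k + n + 1 + 1 by omega) (by omega)
    rw [show k + n + 1 + 1 - 1 = k + n + 1 by omega,
      show k + n + 1 + 1 - 2 = k + n by omega] at hrec
    set d1 := harm q p1 p2 (k + 1) (k + n + 1) - harm q p1 p2 (k + 1) (k + n) with hd1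
    set d2 := harm q p1 p2 (k + 1) (k + n + 1 + 1) - harm q p1 p2 (k + 1) (k + n + 1) with hd2
    have hd : harm q p1 p2 (k + 1) (k + n + 1 + 1 + 1) - harm q p1 p2 (k + 1) (k + n + 1 + 1) =
        (p1 (k + n + 1 + 1) + p2 (k + n + 1 + 1)) / q (k + n + 1 + 1) * d2 +
          p2 (k + n + 1 + 1) / q (k + n + 1 + 1) * d1 := by
      rw [hrec]; ring
    rw [hd, pr_succ (show k ≤ k + n + 1 by omega)]
    rw [pr_succ (show k ≤ k + n by omega)] at l2 u2 ⊢
    have hP := pr_pos hy (show 2 ≤ k by omega) (k + n)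
    set P := pr q p1 p2 k (k + n) with hPd
    have hx2 : 2 ≤ k + n + 1 + 1 := by omega
    have sq := rho_sq hy hx2
    have rA := A_le_rho hy hx2
    have c1 := hr.ca (k + n + 1 + 1) (by omega)
    have c2 := hr.cpos
    have r1 := hr.lo (k + n + 1) (by omega)
    have r2 := hr.lo (k + n + 1 + 1) (by omega)
    have r3 := hr.hi (k + n + 1) (by omega)
    have r4 := hr.hi (k + n + 1 + 1) (by omega)
    have m0 := hr.mono (k + n) (by omega)
    have m1 := hr.mono (k + n + 1) (by omega)
    have hB : 0 < p2 (k + n + 1 + 1) / q (k + n + 1 + 1) :=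
      div_pos (hy.hp2 _ hx2) (hy.hq _ hx2)
    have hBA : p2 (k + n + 1 + 1) / q (k + n + 1 + 1) ≤
        (p1 (k + n + 1 + 1) + p2 (k + n + 1 + 1)) / q (k + n + 1 + 1) := by
      have := (hy.hq _ hx2)
      have := (hy.hp1 _ hx2)
      gcongr; linarith
    set A := (p1 (k + n + 1 + 1) + p2 (k + n + 1 + 1)) / q (k + n + 1 + 1) with hA
    set B := p2 (k + n + 1 + 1) / q (k + n + 1 + 1) with hBd
    set s := rho q p1 p2 (k + n + 1 + 1) with hs
    set r := rho q p1 p2 (k + n + 1) with hrd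
    set t := rho q p1 p2 (k + n) with htd
    set z := rho q p1 p2 k with hz
    have hA0 : 0 < A := by linarith
    -- exact relation
    have key : A * r + B - r * s = B * (s - r) / s := by
      have hs0 : s ≠ 0 := by linarith
      field_simp
      have : A * s = s ^ 2 - B := by linarith
      calc s * (A * r + B - r * s) = (A * s) * r + B * s - r * s ^ 2 := by ring
        _ = B * (s - r) := by rw [this]; ring
    constructor
    · have k1 : r * s ≤ A * r + B := by
        have : 0 ≤ B * (s - r) / s :=
          div_nonneg (mul_nonneg hB.le (by linarith)) (by linarith)
        linarith
      calc c * (P * r * s) = (c * P) * (r * s) := by ring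
        _ ≤ (c * P) * (A * r + B) := by gcongr
        _ = A * (c * (P * r)) + B * (c * P) := by ring
        _ ≤ A * d2 + B * d1 := by gcongr
    · have k1 : A * r + B ≤ r * s * (1 + 8 * (s - r)) := by
        have k2 : B * (s - r) / s ≤ r * s * (8 * (s - r)) := by
          rw [div_le_iff₀ (by linarith)]
          have k3 : B ≤ r * s * 8 * s := by
            have : (1 / 2 : ℝ) * (1 / 2) * 8 * (1 / 2) ≤ r * s * 8 * s := by gcongr
            linarith
          have := mul_le_mul_of_nonneg_right k3 (show 0 ≤ s - r by linarith)
          linarith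
        linarith
      have k4 : 1 + 8 * (s - r) ≤ Real.exp (8 * (s - r)) := by
        have := Real.add_one_le_exp (8 * (s - r)); linarith
      have k5 : Real.exp (8 * (t - z)) ≤ Real.exp (8 * (r - z)) :=
        Real.exp_le_exp.2 (by linarith)
      have k6 : Real.exp (8 * (s - z)) = Real.exp (8 * (s - r)) * Real.exp (8 * (r - z)) := by
        rw [← Real.exp_add]; congr 1; ring
      calc A * d2 + B * d1 ≤ A * (P * r * Real.exp (8 * (r - z))) +
            B * (P * Real.exp (8 * (r - z))) := by
            gcongr
            exact u1.trans (by gcongr)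
        _ = P * Real.exp (8 * (r - z)) * (A * r + B) := by ring
        _ ≤ P * Real.exp (8 * (r - z)) * (r * s * Real.exp (8 * (s - r))) := by
            gcongr
            exact k1.trans (by gcongr)
        _ = P * r * s * Real.exp (8 * (s - z)) := by rw [k6]; ring

lemma Dfin_succ {k x : ℕ} (h : k ≤ x) :
    Dfin q p1 p2 k (x + 1) = Dfin q p1 p2 k x + pr q p1 p2 k x := by
  unfold Dfin
  rw [Finset.sum_Ico_succ_top h]

lemma harm_bounds (hy : Hyp q p1 p2) (hr : Reg q p1 p2 K0 c) {k x : ℕ} (hk : K0 ≤ k)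
    (hx : k ≤ x) : c * Dfin q p1 p2 k x ≤ harm q p1 p2 (k + 1) x ∧
      harm q p1 p2 (k + 1) x ≤ Real.exp 8 * Dfin q p1 p2 k x := by
  induction x, hx using Nat.le_induction with
  | base => simp [Dfin, harm_lt]
  | succ x hx ih =>
    rw [Dfin_succ hx]
    obtain ⟨n, rfl⟩ := Nat.exists_eq_add_of_le hx
    obtain ⟨h1, h2⟩ := incr_bounds hy hr hk n
    have h3 : Real.exp (8 * (rho q p1 p2 (k + n) - rho q p1 p2 k)) ≤ Real.exp 8 := by
      refine Real.exp_le_exp.2 ?_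
      have := hr.hi (k + n) (by omega)
      have := hr.lo k hk
      linarith
    have h4 := mul_le_mul_of_nonneg_left h3 (pr_pos hy (hr.two.trans hk) (k + n)).le
    constructor
    · linarith [ih.1]
    · linarith [ih.2]

lemma Dfin_pos (hy : Hyp q p1 p2) {k x : ℕ} (hk : 2 ≤ k) (hx : k < x) :
    0 < Dfin q p1 p2 k x :=
  Finset.sum_pos (fun i _ => pr_pos hy hk i) ⟨k, by simp [hx]⟩

lemma Dfin_nonneg (hy : Hyp q p1 p2) {k : ℕ} (hk : 2 ≤ k) (x : ℕ) :
    0 ≤ Dfin q p1 p2 k x :=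
  Finset.sum_nonneg (fun i _ => (pr_pos hy hk i).le)

lemma Dfin_le (hy : Hyp q p1 p2) (hr : Reg q p1 p2 K0 c) {k x : ℕ} (hk : K0 ≤ k) (hx : k ≤ x) :
    Dfin q p1 p2 k x ≤ (x : ℝ) - k := by
  unfold Dfin
  refine (Finset.sum_le_card_nsmul _ _ 1 fun i _ => pr_le_one hy hr hk i).trans ?_
  simp [Nat.cast_sub hx]

lemma q_bounds (hy : Hyp q p1 p2) (hr : Reg q p1 p2 K0 c) {k : ℕ} (hk : K0 ≤ k) :
    1 / 2 ≤ q k ∧ q k ≤ 1 := by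
  have h2 := hr.two.trans hk
  have h1 := (A_le_rho hy h2).trans (hr.hi k hk)
  rw [div_le_one (hy.hq k h2)] at h1
  have := hy.hsum k h2
  have := hy.hp1 k h2
  have := hy.hp2 k h2
  constructor <;> linarith

lemma DX_eq (k : ℕ) : DX q p1 p2 k = ∑' i, ENNReal.ofReal (pr q p1 p2 k (k + i)) := by
  rw [tsum_eq_zero_add' ENNReal.summable, Nat.add_zero, pr_self, ENNReal.ofReal_one, DX]
  congr 1
  refine tsum_congr fun j => ?_
  congr 1
  unfold pr
  refine Finset.prod_congr ?_ fun _ _ => rfl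
  ext i; simp; omega

lemma sum_ofReal_pr (hy : Hyp q p1 p2) {k : ℕ} (hk : 2 ≤ k) (n : ℕ) :
    ∑ i ∈ Finset.range n, ENNReal.ofReal (pr q p1 p2 k (k + i)) =
      ENNReal.ofReal (Dfin q p1 p2 k (k + n)) := by
  rw [← ENNReal.ofReal_sum_of_nonneg (fun i _ => (pr_pos hy hk _).le)]
  congr 1
  unfold Dfin
  rw [Finset.sum_Ico_eq_sum_range]
  simp

lemma tendsto_Dfin (hy : Hyp q p1 p2) {k : ℕ} (hk : 2 ≤ k) :
    Tendsto (fun n => ENNReal.ofReal (Dfin q p1 p2 k (k + n))) atTop (𝓝 (DX q p1 p2 k)) := by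
  rw [DX_eq]
  simp only [← sum_ofReal_pr hy hk]
  exact ENNReal.tendsto_nat_tsum _

lemma DX_split (hy : Hyp q p1 p2) {k x : ℕ} (hk : 2 ≤ k) (hx : k ≤ x) :
    DX q p1 p2 k = ENNReal.ofReal (Dfin q p1 p2 k x) +
      ENNReal.ofReal (pr q p1 p2 k x) * DX q p1 p2 x := by
  obtain ⟨n, rfl⟩ := Nat.exists_eq_add_of_le hx
  rw [DX_eq, DX_eq, ← sum_ofReal_pr hy hk, ← ENNReal.tsum_mul_left,
    ← Summable.sum_add_tsum_nat_add' (k := n) ENNReal.summable]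
  congr 1
  refine tsum_congr fun i => ?_
  rw [← ENNReal.ofReal_mul (pr_pos hy hk _).le, show k + (i + n) = k + n + i by ring,
    ← pr_mul (by omega) (by omega)]

variable {μ : Measure (ℕ → ℕ)} [IsProbabilityMeasure μ]

lemma AA_lower (hy : Hyp q p1 p2) (hr : Reg q p1 p2 K0 c)
    (hμ : IsMarkovChain μ (transX q p1 p2) 2) {j k : ℕ} (hj : K0 ≤ j) (hjk : j < k) :
    ENNReal.ofReal (1 / (2 * Real.exp 8) * (1 / Dfin q p1 p2 j k)) ≤ μ (AA j k) := by
  rw [measure_AA hy hμ (hr.two.trans hj) hjk]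
  refine ENNReal.ofReal_le_ofReal ?_
  have h1 := (q_bounds hy hr hj).1
  have h2 := (harm_bounds hy hr hj hjk.le).2
  have h3 := harm_pos hy (show j + 1 ≤ k by omega)
  have h4 := Dfin_pos hy (hr.two.trans hj) hjk
  calc 1 / (2 * Real.exp 8) * (1 / Dfin q p1 p2 j k)
      = (1 / 2) / (Real.exp 8 * Dfin q p1 p2 j k) := by field_simp
    _ ≤ _ := by gcongr

lemma AA_upper (hy : Hyp q p1 p2) (hr : Reg q p1 p2 K0 c)
    (hμ : IsMarkovChain μ (transX q p1 p2) 2) {j k : ℕ} (hj : K0 ≤ j) (hjk : j < k) :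
    μ (AA j k) ≤ ENNReal.ofReal (1 / c * (1 / Dfin q p1 p2 j k)) := by
  rw [measure_AA hy hμ (hr.two.trans hj) hjk]
  refine ENNReal.ofReal_le_ofReal ?_
  have h1 := (q_bounds hy hr hj).2
  have h2 := (harm_bounds hy hr hj hjk.le).1
  have h4 := Dfin_pos hy (hr.two.trans hj) hjk
  have h5 := hr.cpos
  calc q j / harm q p1 p2 (j + 1) k ≤ 1 / (c * Dfin q p1 p2 j k) := by gcongr
    _ = _ := by field_simp

lemma CC_upper (hy : Hyp q p1 p2) (hr : Reg q p1 p2 K0 c)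
    (hμ : IsMarkovChain μ (transX q p1 p2) 2) {k : ℕ} (hk : K0 ≤ k) :
    μ (CC k) ≤ ENNReal.ofReal (1 / c) * (DX q p1 p2 k)⁻¹ := by
  have h2 := hr.two.trans hk
  have h5 := hr.cpos
  have t1 : Tendsto (fun n => μ (AA k (k + n))) atTop (𝓝 (μ (CC k))) :=
    (measure_CC_tendsto k).comp (tendsto_atTop_mono (fun n => Nat.le_add_left n k) tendsto_id)
  have t2 : Tendsto (fun n => ENNReal.ofReal (1 / c) * (ENNReal.ofReal (Dfin q p1 p2 k (k + n)))⁻¹)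
      atTop (𝓝 (ENNReal.ofReal (1 / c) * (DX q p1 p2 k)⁻¹)) :=
    ENNReal.Tendsto.const_mul (tendsto_Dfin hy h2).inv (Or.inr ENNReal.ofReal_ne_top)
  refine le_of_tendsto_of_tendsto t1 t2 ?_
  filter_upwards [eventually_gt_atTop 0] with n hn
  refine (AA_upper hy hr hμ hk (by omega)).trans ?_
  rw [ENNReal.ofReal_mul (by positivity), one_div (Dfin _ _ _ _ _),
    ENNReal.ofReal_inv_of_pos (Dfin_pos hy h2 (by omega))]

lemma CC_lower (hy : Hyp q p1 p2) (hr : Reg q p1 p2 K0 c)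
    (hμ : IsMarkovChain μ (transX q p1 p2) 2) {k : ℕ} (hk : K0 ≤ k) :
    ENNReal.ofReal (1 / (2 * Real.exp 8)) * (DX q p1 p2 k)⁻¹ ≤ μ (CC k) := by
  have h2 := hr.two.trans hk
  have t1 : Tendsto (fun n => μ (AA k (k + n))) atTop (𝓝 (μ (CC k))) :=
    (measure_CC_tendsto k).comp (tendsto_atTop_mono (fun n => Nat.le_add_left n k) tendsto_id)
  have t2 : Tendsto (fun n => ENNReal.ofReal (1 / (2 * Real.exp 8)) *
      (ENNReal.ofReal (Dfin q p1 p2 k (k + n)))⁻¹)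
      atTop (𝓝 (ENNReal.ofReal (1 / (2 * Real.exp 8)) * (DX q p1 p2 k)⁻¹)) :=
    ENNReal.Tendsto.const_mul (tendsto_Dfin hy h2).inv (Or.inr ENNReal.ofReal_ne_top)
  refine le_of_tendsto_of_tendsto t2 t1 ?_
  filter_upwards [eventually_gt_atTop 0] with n hn
  refine le_trans ?_ (AA_lower hy hr hμ hk (by omega))
  rw [ENNReal.ofReal_mul (by positivity), one_div (Dfin _ _ _ _ _),
    ENNReal.ofReal_inv_of_pos (Dfin_pos hy h2 (by omega))]

end est


variable {q p1 p2 : ℕ → ℝ} {K0 : ℕ} {c : ℝ}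
variable {μ : Measure (ℕ → ℕ)} [IsProbabilityMeasure μ]

/-! ### Part 1: the convergent case -/

/-- `k` is the last index up to `b` for which `CC` holds. -/
def LL (b k : ℕ) : Set (ℕ → ℕ) := CC k ∩ ⋂ l ∈ Finset.Ioc k b, (CC l)ᶜ

lemma measurableSet_fut_LL (b k : ℕ) : MeasurableSet[fut k] (LL b k) := by
  refine MeasurableSet.inter (m := fut k) (measurableSet_fut_CC le_rfl) ?_
  refine Finset.measurableSet_biInter (m := fut k) _ fun l hl => ?_
  exact MeasurableSet.compl (m := fut k) (measurableSet_fut_CC (Finset.mem_Ioc.1 hl).1.le)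

lemma measurableSet_LL (b k : ℕ) : MeasurableSet (LL b k) :=
  fut_le k _ (measurableSet_fut_LL b k)

lemma LL_disjoint (b : ℕ) {k l : ℕ} (hkl : k < l) (hl : l ≤ b) : Disjoint (LL b k) (LL b l) := by
  rw [Set.disjoint_left]
  rintro ω ⟨_, h⟩ ⟨h', _⟩
  exact (Set.mem_iInter₂.1 h l (Finset.mem_Ioc.2 ⟨hkl, hl⟩)) h'

lemma LL_cover (a b : ℕ) : (⋃ k ∈ Finset.Ioc a b, CC k) ⊆ ⋃ k ∈ Finset.Ioc a b, LL b k := by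
  classical
  intro ω hω
  obtain ⟨k, hk, hC⟩ := Set.mem_iUnion₂.1 hω
  have hne : ((Finset.Ioc a b).filter (fun k => ω ∈ CC k)).Nonempty :=
    ⟨k, Finset.mem_filter.2 ⟨hk, hC⟩⟩
  set M := ((Finset.Ioc a b).filter (fun k => ω ∈ CC k)).max' hne with hM
  have hMm := Finset.max'_mem _ hne
  rw [← hM, Finset.mem_filter] at hMm
  refine Set.mem_iUnion₂.2 ⟨M, hMm.1, hMm.2, Set.mem_iInter₂.2 fun l hl hCl => ?_⟩
  have h1 := Finset.mem_Ioc.1 hl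
  have h2 := Finset.mem_Ioc.1 hMm.1
  have := Finset.le_max' ((Finset.Ioc a b).filter (fun k => ω ∈ CC k)) l
    (Finset.mem_filter.2 ⟨Finset.mem_Ioc.2 ⟨h2.1.trans h1.1, h1.2⟩, hCl⟩)
  rw [← hM] at this
  omega

lemma CC_inter_LL {b j k : ℕ} (hjk : j < k) : CC j ∩ LL b k = AA j k ∩ LL b k := by
  unfold LL
  rw [← Set.inter_assoc, ← Set.inter_assoc, CC_inter hjk]

lemma block_bound (hy : Hyp q p1 p2) (hμ : IsMarkovChain μ (transX q p1 p2) 2)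
    (lo a b : ℕ) (H : ℝ≥0∞)
    (hH : ∀ k ∈ Finset.Ioc a b, H ≤ ∑ j ∈ Finset.Ico (lo + 1) k, μ (AA j k)) :
    H * μ (⋃ k ∈ Finset.Ioc a b, CC k) ≤ ∑ j ∈ Finset.Ioc lo b, μ (CC j) := by
  classical
  calc H * μ (⋃ k ∈ Finset.Ioc a b, CC k)
      ≤ H * ∑ k ∈ Finset.Ioc a b, μ (LL b k) := by
        gcongr
        exact (measure_mono (LL_cover a b)).trans (measure_biUnion_finset_le _ _)
    _ = ∑ k ∈ Finset.Ioc a b, H * μ (LL b k) := by rw [Finset.mul_sum]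
    _ ≤ ∑ k ∈ Finset.Ioc a b, ∑ j ∈ Finset.Ico (lo + 1) k, μ (CC j ∩ LL b k) := by
        refine Finset.sum_le_sum fun k hk => ?_
        calc H * μ (LL b k) ≤ (∑ j ∈ Finset.Ico (lo + 1) k, μ (AA j k)) * μ (LL b k) := by
              gcongr; exact hH k hk
          _ = _ := by
              rw [Finset.sum_mul]
              refine Finset.sum_congr rfl fun j hj => ?_
              have := (Finset.mem_Ico.1 hj).2
              rw [CC_inter_LL this, indep_AA hy hμ j k (measurableSet_fut_LL b k)]
    _ ≤ ∑ k ∈ Finset.Ioc a b, ∑ j ∈ Finset.Ioc lo b, μ (CC j ∩ LL b k) := by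
        refine Finset.sum_le_sum fun k hk => Finset.sum_le_sum_of_subset fun j hj => ?_
        rw [Finset.mem_Ico] at hj
        rw [Finset.mem_Ioc] at hk ⊢
        omega
    _ = ∑ j ∈ Finset.Ioc lo b, ∑ k ∈ Finset.Ioc a b, μ (CC j ∩ LL b k) := Finset.sum_comm
    _ ≤ ∑ j ∈ Finset.Ioc lo b, μ (CC j) := by
        refine Finset.sum_le_sum fun j _ => ?_
        rw [← measure_biUnion_finset]
        · exact measure_mono (Set.iUnion₂_subset fun _ _ => Set.inter_subset_left)
        · intro k hk l hl hkl
          have hk := (Finset.mem_Ioc.1 hk).2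
          have hl := (Finset.mem_Ioc.1 hl).2
          rcases lt_or_gt_of_ne hkl with h | h
          · exact (LL_disjoint b h hl).mono Set.inter_subset_right Set.inter_subset_right
          · exact (LL_disjoint b h hk).symm.mono Set.inter_subset_right Set.inter_subset_right
        · exact fun k _ => (measurableSet_CC j).inter (measurableSet_LL b k)

lemma sum_inv_sub (lo k : ℕ) (h : lo < k) :
    ∑ j ∈ Finset.Ico (lo + 1) k, 1 / ((k : ℝ) - j) = ((harmonic (k - lo - 1) : ℚ) : ℝ) := by
  rw [Finset.sum_Ico_eq_sum_range, ← Finset.sum_range_reflect, harmonic]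
  push_cast
  have e : k - (lo + 1) = k - lo - 1 := by omega
  rw [e]
  refine Finset.sum_congr rfl fun i hi => ?_
  have hi := Finset.mem_range.1 hi
  rw [one_div]
  congr 1
  have : (k : ℝ) = (((lo + 1) + (k - lo - 1 - 1 - i) + (i + 1) : ℕ) : ℝ) := by
    congr 1; omega
  rw [this]; push_cast; ring

lemma AA_sum_lower (hy : Hyp q p1 p2) (hr : Reg q p1 p2 K0 c)
    (hμ : IsMarkovChain μ (transX q p1 p2) 2) {lo k n : ℕ} (hlo : K0 ≤ lo) (hn : 0 < n)
    (hk : lo + n ≤ k) :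
    ENNReal.ofReal (1 / (2 * Real.exp 8) * Real.log n) ≤
      ∑ j ∈ Finset.Ico (lo + 1) k, μ (AA j k) := by
  calc ENNReal.ofReal (1 / (2 * Real.exp 8) * Real.log n)
      ≤ ENNReal.ofReal (∑ j ∈ Finset.Ico (lo + 1) k,
          1 / (2 * Real.exp 8) * (1 / ((k : ℝ) - j))) := by
        apply ENNReal.ofReal_le_ofReal
        rw [← Finset.mul_sum, sum_inv_sub lo k (by omega)]
        gcongr
        refine le_trans ?_ (log_add_one_le_harmonic _)
        apply Real.log_le_log (by exact_mod_cast hn)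
        have : n ≤ k - lo - 1 + 1 := by omega
        exact_mod_cast this
    _ = ∑ j ∈ Finset.Ico (lo + 1) k, ENNReal.ofReal
          (1 / (2 * Real.exp 8) * (1 / ((k : ℝ) - j))) := by
        rw [ENNReal.ofReal_sum_of_nonneg]
        intro j hj
        have : (j : ℝ) < k := by exact_mod_cast (Finset.mem_Ico.1 hj).2
        have : 0 < (k : ℝ) - j := by linarith
        positivity
    _ ≤ _ := by
        refine Finset.sum_le_sum fun j hj => ?_
        have hj := Finset.mem_Ico.1 hj
        refine le_trans (ENNReal.ofReal_le_ofReal ?_) (AA_lower hy hr hμ (by omega) hj.2)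
        have h0 : 0 < Dfin q p1 p2 j k := Dfin_pos hy (by have := hr.two; omega) hj.2
        have h1 : Dfin q p1 p2 j k ≤ (k : ℝ) - j := Dfin_le hy hr (by omega) hj.2.le
        gcongr

/-- The summand of the criterion. -/
def ff (q p1 p2 : ℕ → ℝ) (n : ℕ) : ℝ≥0∞ :=
  (DX q p1 p2 n * ENNReal.ofReal (Real.log n))⁻¹

lemma ff_eq {n : ℕ} (hn : 2 ≤ n) :
    ff q p1 p2 n = (DX q p1 p2 n)⁻¹ * (ENNReal.ofReal (Real.log n))⁻¹ := by
  have : 0 < Real.log n := Real.log_pos (by exact_mod_cast hn)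
  unfold ff
  rw [ENNReal.mul_inv (Or.inr ENNReal.ofReal_ne_top)
    (Or.inr (by simpa using this))]

lemma sum_dyadic (f : ℕ → ℝ≥0∞) :
    ∑' m, ∑ j ∈ Finset.Ioc (2 ^ m) (2 ^ (m + 1)), f j ≤ ∑' n, f (n + 2) := by
  have key : ∀ M, ∑ m ∈ Finset.range M, ∑ j ∈ Finset.Ioc (2 ^ m) (2 ^ (m + 1)), f j
      = ∑ j ∈ Finset.Ioc 1 (2 ^ M), f j := by
    intro M
    induction M with
    | zero => simp
    | succ M ih =>
      rw [Finset.sum_range_succ, ih]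
      exact Finset.sum_Ioc_consecutive f Nat.one_le_two_pow
        (Nat.pow_le_pow_right (by norm_num) (by omega))
  rw [ENNReal.tsum_eq_iSup_nat]
  refine iSup_le fun M => ?_
  rw [key]
  have : Finset.Ioc 1 (2 ^ M) = Finset.Ico 2 (2 ^ M + 1) := by
    ext x; simp only [Finset.mem_Ioc, Finset.mem_Ico]; omega
  rw [this, Finset.sum_Ico_eq_sum_range]
  simp_rw [add_comm 2]
  exact ENNReal.sum_le_tsum _

lemma block_measure (hy : Hyp q p1 p2) (hr : Reg q p1 p2 K0 c)
    (hμ : IsMarkovChain μ (transX q p1 p2) 2) {m : ℕ} (hm : 1 ≤ m) (hK : K0 ≤ 2 ^ m) :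
    μ (⋃ k ∈ Finset.Ioc (2 ^ (m + 1)) (2 ^ (m + 2)), CC k) ≤
      ENNReal.ofReal (1 / c * (6 * Real.exp 8)) *
        ∑ j ∈ Finset.Ioc (2 ^ m) (2 ^ (m + 2)), ff q p1 p2 j := by
  have hl2 : 0 < Real.log 2 := Real.log_pos (by norm_num)
  have hmr : (1 : ℝ) ≤ m := by exact_mod_cast hm
  have hc := hr.cpos
  set h : ℝ := 1 / (2 * Real.exp 8) * Real.log ((2 ^ m : ℕ) : ℝ) with hh
  have hlog : Real.log ((2 ^ m : ℕ) : ℝ) = m * Real.log 2 := by push_cast; rw [Real.log_pow]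
  have hpos : 0 < h := by rw [hh, hlog]; positivity
  have hb := block_bound hy hμ (2 ^ m) (2 ^ (m + 1)) (2 ^ (m + 2))
    (ENNReal.ofReal h) (by
      intro k hk
      have := (Finset.mem_Ioc.1 hk).1
      have e : 2 ^ (m + 1) = 2 ^ m + 2 ^ m := by ring
      exact AA_sum_lower hy hr hμ hK (by positivity) (by omega))
  rw [mul_comm, ← ENNReal.le_div_iff_mul_le (Or.inl (by simpa using hpos))
    (Or.inl ENNReal.ofReal_ne_top)] at hb
  refine hb.trans ?_
  rw [ENNReal.div_eq_inv_mul, Finset.mul_sum, Finset.mul_sum]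
  refine Finset.sum_le_sum fun j hj => ?_
  have hj := Finset.mem_Ioc.1 hj
  have h2 := hr.two
  have hj2 : 2 ≤ j := by omega
  have hlj : 0 < Real.log j := Real.log_pos (by exact_mod_cast hj2)
  rw [ff_eq hj2]
  calc (ENNReal.ofReal h)⁻¹ * μ (CC j)
      ≤ (ENNReal.ofReal h)⁻¹ * (ENNReal.ofReal (1 / c) * (DX q p1 p2 j)⁻¹) := by
        gcongr; exact CC_upper hy hr hμ (by omega)
    _ = (ENNReal.ofReal (h⁻¹ * (1 / c))) * (DX q p1 p2 j)⁻¹ := by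
        rw [ENNReal.ofReal_mul (p := h⁻¹) (by positivity), ENNReal.ofReal_inv_of_pos hpos,
          mul_assoc]
    _ ≤ (ENNReal.ofReal (1 / c * (6 * Real.exp 8) * (Real.log j)⁻¹)) * (DX q p1 p2 j)⁻¹ := by
        refine mul_le_mul_left (ENNReal.ofReal_le_ofReal ?_) _
        rw [mul_comm, mul_assoc]
        refine mul_le_mul_of_nonneg_left ?_ (by positivity)
        have hle : Real.log j ≤ (m + 2) * Real.log 2 := by
          have : Real.log ((2 ^ (m + 2) : ℕ) : ℝ) = (m + 2) * Real.log 2 := by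
            push_cast; rw [Real.log_pow]; push_cast; ring
          rw [← this]
          apply Real.log_le_log (by positivity)
          exact_mod_cast hj.2
        rw [← div_eq_mul_inv, le_div_iff₀ hlj, inv_mul_le_iff₀ hpos, hh, hlog]
        have : 1 / (2 * Real.exp 8) * (m * Real.log 2) * (6 * Real.exp 8)
            = 3 * m * Real.log 2 := by field_simp; ring
        rw [this]
        nlinarith
    _ = _ := by
        rw [ENNReal.ofReal_mul (by positivity), ENNReal.ofReal_inv_of_pos hlj]
        ring

lemma part_one (hy : Hyp q p1 p2) (hr : Reg q p1 p2 K0 c)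
    (hμ : IsMarkovChain μ (transX q p1 p2) 2) (hs : ∑' n, ff q p1 p2 (n + 2) ≠ ⊤) :
    ∀ᵐ ω ∂μ, {k : ℕ | ∃! n, ω n = k}.Finite := by
  obtain ⟨m0, hm0⟩ : ∃ m0 : ℕ, K0 ≤ 2 ^ m0 := ⟨K0, Nat.lt_two_pow_self.le⟩
  set S : ℕ → ℝ≥0∞ := fun m => ∑ j ∈ Finset.Ioc (2 ^ m) (2 ^ (m + 1)), ff q p1 p2 j with hS
  have hSle : ∑' m, S m ≤ ∑' n, ff q p1 p2 (n + 2) := sum_dyadic _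
  have hsh : ∀ r, ∑' m, S (m + r) ≤ ∑' m, S m := fun r =>
    ENNReal.tsum_comp_le_tsum_of_injective (add_left_injective r) S
  set E : ℕ → Set (ℕ → ℕ) := fun i =>
    ⋃ k ∈ Finset.Ioc (2 ^ (i + (m0 + 1) + 1)) (2 ^ (i + (m0 + 1) + 2)), CC k with hE
  have hsum : ∑' i, μ (E i) ≠ ⊤ := by
    have : ∑' i, μ (E i) ≤ ∑' i, ENNReal.ofReal (1 / c * (6 * Real.exp 8)) *
        (S (i + (m0 + 1)) + S (i + (m0 + 2))) := by
      refine ENNReal.tsum_le_tsum fun i => ?_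
      refine (block_measure hy hr hμ (by omega) (hm0.trans
        (Nat.pow_le_pow_right (by norm_num) (by omega)))).trans (le_of_eq ?_)
      congr 1
      rw [hS]
      exact (Finset.sum_Ioc_consecutive _ (Nat.pow_le_pow_right (by norm_num) (by omega))
        (Nat.pow_le_pow_right (by norm_num) (by omega))).symm
    refine ne_top_of_le_ne_top ?_ this
    rw [ENNReal.tsum_mul_left, ENNReal.tsum_add]
    refine ENNReal.mul_ne_top ENNReal.ofReal_ne_top (ENNReal.add_ne_top.2 ⟨?_, ?_⟩)
    · exact ne_top_of_le_ne_top hs ((hsh _).trans hSle)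
    · exact ne_top_of_le_ne_top hs ((hsh _).trans hSle)
  have hBC : ∀ᵐ ω ∂μ, ∀ᶠ i in atTop, ω ∉ E i := ae_eventually_notMem hsum
  filter_upwards [hBC, ae_good hy hμ] with ω h1 h2
  obtain ⟨I, hI⟩ := eventually_atTop.1 h1
  refine (Set.finite_Iic (2 ^ (I + (m0 + 1) + 1))).subset fun k hk => ?_
  by_contra hlt
  rw [Set.mem_Iic, not_le] at hlt
  have hk2 : 2 ≤ k := by
    have : 0 < 2 ^ (I + (m0 + 1) + 1) := by positivity
    omega
  have hC := CC_of_cut h2 hk2 hk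
  -- locate the dyadic block
  have hex : ∃ i, k ≤ 2 ^ (i + (m0 + 1) + 2) := ⟨k, by
    refine Nat.lt_two_pow_self.le.trans (Nat.pow_le_pow_right (by norm_num) (by omega))⟩
  classical
  set i := Nat.find hex with hi
  have hi1 : k ≤ 2 ^ (i + (m0 + 1) + 2) := Nat.find_spec hex
  have hi0 : I ≤ i := by
    by_contra hcon
    have : 2 ^ (i + (m0 + 1) + 2) ≤ 2 ^ (I + (m0 + 1) + 1) :=
      Nat.pow_le_pow_right (by norm_num) (by omega)
    omega
  have hi2 : 2 ^ (i + (m0 + 1) + 1) < k := by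
    rcases Nat.eq_zero_or_pos i with h | h
    · rw [h]
      have : I = 0 := by omega
      rw [this] at hlt; exact hlt
    · have := Nat.find_min hex (m := i - 1) (by omega)
      rw [not_le] at this
      have e : i - 1 + (m0 + 1) + 2 = i + (m0 + 1) + 1 := by omega
      rwa [e] at this
  exact hI i hi0 (Set.mem_iUnion₂.2 ⟨k, Finset.mem_Ioc.2 ⟨hi2, hi1⟩, hC⟩)

/-! ### Part 2: the divergent case -/

lemma kochen_stone (F : Finset ℕ) (w : ℕ → ℝ) (hw0 : ∀ k ∈ F, 0 ≤ w k) (hw1 : ∀ k ∈ F, w k ≤ 1)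
    (H1 H2 : ℝ) (h1 : 0 ≤ H1) (h2 : 0 ≤ H2)
    (hs : 1 ≤ ∑ k ∈ F, w k * μ.real (CC k))
    (hF : ∀ j ∈ F, ∑ k ∈ F with j < k, w k * μ.real (CC j ∩ CC k) ≤
      μ.real (CC j) * (H1 * ∑ k ∈ F, w k * μ.real (CC k) + H2)) :
    1 ≤ (2 * H1 + 2 * H2 + 1) * μ.real (⋃ k ∈ F, CC k) := by
  classical
  set U : Set (ℕ → ℕ) := ⋃ k ∈ F, CC k with hU
  have hUm : MeasurableSet U := Finset.measurableSet_biUnion _ fun k _ => measurableSet_CC k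
  set s : ℝ := ∑ k ∈ F, w k * μ.real (CC k) with hs'
  set N : (ℕ → ℕ) → ℝ := fun ω => ∑ k ∈ F, w k * (CC k).indicator 1 ω with hN
  have hintg : ∀ A : Set (ℕ → ℕ), MeasurableSet A →
      Integrable (fun ω => A.indicator (1 : (ℕ → ℕ) → ℝ) ω) μ := fun A hA =>
    (integrable_const (1 : ℝ)).indicator hA
  have hintv : ∀ A : Set (ℕ → ℕ), MeasurableSet A →
      ∫ ω, A.indicator (1 : (ℕ → ℕ) → ℝ) ω ∂μ = μ.real A := fun A hA => integral_indicator_one hA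
  have hNint : Integrable N μ :=
    integrable_finsetSum _ fun k _ => (hintg _ (measurableSet_CC k)).const_mul _
  have hEN : ∫ ω, N ω ∂μ = s := by
    rw [hN, integral_finsetSum _ fun k _ => (hintg _ (measurableSet_CC k)).const_mul _]
    refine Finset.sum_congr rfl fun k _ => ?_
    rw [integral_const_mul, hintv _ (measurableSet_CC k)]
  have hN2 : ∀ ω, N ω ^ 2 = ∑ j ∈ F, ∑ k ∈ F, w j * w k * (CC j ∩ CC k).indicator 1 ω := by
    intro ω
    rw [pow_two, hN, Finset.sum_mul_sum]
    refine Finset.sum_congr rfl fun j _ => Finset.sum_congr rfl fun k _ => ?_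
    rw [Set.inter_indicator_one, Pi.mul_apply]
    ring
  have hi2 : ∀ j k : ℕ, Integrable (fun ω => w j * w k *
      (CC j ∩ CC k).indicator (1 : (ℕ → ℕ) → ℝ) ω) μ := fun j k =>
    (hintg _ ((measurableSet_CC j).inter (measurableSet_CC k))).const_mul _
  have hN2int : Integrable (fun ω => N ω ^ 2) μ := by
    simp_rw [hN2]
    exact integrable_finsetSum _ fun j _ => integrable_finsetSum _ fun k _ => hi2 j k
  set g : ℕ → ℕ → ℝ := fun j k => w j * w k * μ.real (CC j ∩ CC k) with hg
  have hEN2 : ∫ ω, N ω ^ 2 ∂μ = ∑ j ∈ F, ∑ k ∈ F, g j k := by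
    simp_rw [hN2]
    rw [integral_finsetSum _ fun j _ => integrable_finsetSum _ fun k _ => hi2 j k]
    refine Finset.sum_congr rfl fun j _ => ?_
    rw [integral_finsetSum _ fun k _ => hi2 j k]
    refine Finset.sum_congr rfl fun k _ => ?_
    rw [integral_const_mul, hintv _ ((measurableSet_CC j).inter (measurableSet_CC k))]
  have hsym : ∀ j k, g j k = g k j := fun j k => by
    simp only [hg]; rw [Set.inter_comm, mul_comm (w j)]
  have hoff : ∑ j ∈ F, ∑ k ∈ F, (if j < k then g j k else 0) ≤ s * (H1 * s + H2) := by
    rw [hs', Finset.sum_mul, ← hs']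
    refine Finset.sum_le_sum fun j hj => ?_
    rw [← Finset.sum_filter]
    calc ∑ k ∈ F with j < k, g j k = w j * ∑ k ∈ F with j < k, w k * μ.real (CC j ∩ CC k) := by
          rw [Finset.mul_sum]
          exact Finset.sum_congr rfl fun k _ => by simp only [hg]; ring
      _ ≤ w j * (μ.real (CC j) * (H1 * s + H2)) :=
          mul_le_mul_of_nonneg_left (hF j hj) (hw0 j hj)
      _ = _ := by ring
  have hdiag : ∑ j ∈ F, ∑ k ∈ F, (if j = k then g j k else 0) ≤ s := by
    refine Finset.sum_le_sum fun j hj => ?_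
    rw [Finset.sum_ite_eq, if_pos hj]
    simp only [hg, Set.inter_self]
    have := mul_le_mul_of_nonneg_left (hw1 j hj) (hw0 j hj)
    rw [mul_one] at this
    exact mul_le_mul_of_nonneg_right this measureReal_nonneg
  have hoff' : ∑ j ∈ F, ∑ k ∈ F, (if k < j then g j k else 0) ≤ s * (H1 * s + H2) := by
    rw [Finset.sum_comm]
    refine le_trans (le_of_eq ?_) hoff
    exact Finset.sum_congr rfl fun j _ => Finset.sum_congr rfl fun k _ => by rw [hsym k j]
  have hsplit : ∑ j ∈ F, ∑ k ∈ F, g j k = ∑ j ∈ F, ∑ k ∈ F, (if j < k then g j k else 0)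
      + ∑ j ∈ F, ∑ k ∈ F, (if j = k then g j k else 0)
      + ∑ j ∈ F, ∑ k ∈ F, (if k < j then g j k else 0) := by
    simp_rw [← Finset.sum_add_distrib]
    refine Finset.sum_congr rfl fun j _ => Finset.sum_congr rfl fun k _ => ?_
    rcases lt_trichotomy j k with h | h | h
    · simp [h, h.ne, h.not_gt]
    · simp [h]
    · simp [h, h.ne', h.not_gt]
  set H : ℝ := 2 * H1 + 2 * H2 + 1 with hH
  have hbound : ∫ ω, N ω ^ 2 ∂μ ≤ H * s ^ 2 := by
    rw [hEN2, hsplit, hH]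
    nlinarith [mul_nonneg h2 (by nlinarith : 0 ≤ s ^ 2 - s)]
  have hHpos : 0 < H := by rw [hH]; positivity
  -- pointwise inequality
  have hpt : ∀ ω, 2 * (H * s) * N ω ≤ N ω ^ 2 + (H * s) ^ 2 * U.indicator 1 ω := by
    intro ω
    by_cases hω : ω ∈ U
    · rw [Set.indicator_of_mem hω, Pi.one_apply]
      nlinarith [sq_nonneg (N ω - H * s)]
    · have : N ω = 0 := by
        simp only [hN]
        refine Finset.sum_eq_zero fun k hk => ?_
        rw [Set.indicator_of_notMem, mul_zero]
        exact fun h => hω (Set.mem_iUnion₂.2 ⟨k, hk, h⟩)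
      rw [Set.indicator_of_notMem hω, this]
      simp
  have hI := integral_mono (hNint.const_mul (2 * (H * s)))
    (g := fun ω => N ω ^ 2 + (H * s) ^ 2 * U.indicator 1 ω)
    (hN2int.add ((hintg U hUm).const_mul ((H * s) ^ 2))) hpt
  rw [integral_const_mul, hEN] at hI
  have e : ∫ ω, (N ω ^ 2 + (H * s) ^ 2 * U.indicator 1 ω) ∂μ
      = ∫ ω, N ω ^ 2 ∂μ + (H * s) ^ 2 * μ.real U := by
    rw [integral_add hN2int ((hintg U hUm).const_mul _), integral_const_mul, hintv U hUm]
  rw [e] at hI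
  have h3 : H * s ^ 2 * 1 ≤ H * s ^ 2 * (H * μ.real U) := by nlinarith
  exact le_of_mul_le_mul_left h3 (by positivity)

lemma loglog_step {i : ℕ} (hi : 2 ≤ i) :
    Real.log (Real.log (i + 1)) - Real.log (Real.log i) ≤ 1 / (i * Real.log i) := by
  have hi' : (2 : ℝ) ≤ i := by exact_mod_cast hi
  have h1 : 0 < Real.log i := Real.log_pos (by linarith)
  have h2 : 0 < Real.log (i + 1) := Real.log_pos (by linarith)
  rw [← Real.log_div h2.ne' h1.ne']
  refine (Real.log_le_sub_one_of_pos (by positivity)).trans ?_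
  have h3 : Real.log (i + 1) - Real.log i ≤ 1 / i := by
    rw [← Real.log_div (by positivity) (by positivity)]
    refine (Real.log_le_sub_one_of_pos (by positivity)).trans (le_of_eq ?_)
    field_simp; ring
  rw [div_sub_one h1.ne', div_le_div_iff₀ h1 (by positivity)]
  have : (Real.log (i + 1) - Real.log i) * i ≤ 1 := by
    rw [le_div_iff₀ (by positivity)] at h3; exact h3
  nlinarith

lemma loglog_sum {j k : ℕ} (hj : 2 ≤ j) (hjk : j ≤ k) :
    Real.log (Real.log k) - Real.log (Real.log j) ≤ ∑ i ∈ Finset.Ico j k, 1 / (i * Real.log i) := by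
  induction k, hjk using Nat.le_induction with
  | base => simp
  | succ k hk ih =>
    rw [Finset.sum_Ico_succ_top hk]
    have := loglog_step (hj.trans hk)
    push_cast
    linarith

lemma sum_inv_sub' (j k : ℕ) (h : j < k) :
    ∑ l ∈ Finset.Ioc j k, 1 / ((l : ℝ) - j) = ((harmonic (k - j) : ℚ) : ℝ) := by
  have : Finset.Ioc j k = Finset.Ico (j + 1) (k + 1) := by
    ext x; simp only [Finset.mem_Ioc, Finset.mem_Ico]; omega
  rw [this, Finset.sum_Ico_eq_sum_range, harmonic]
  have e : k + 1 - (j + 1) = k - j := by omega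
  rw [e]
  push_cast
  refine Finset.sum_congr rfl fun i _ => ?_
  rw [one_div]
  congr 1
  ring

/-- Real-valued estimates valid from `K1` on. -/
structure Est (q p1 p2 : ℕ → ℝ) (μ : Measure (ℕ → ℕ)) (K1 : ℕ) (δ C κ : ℝ) (d : ℕ → ℝ) :
    Prop where
  three : 3 ≤ K1
  dpos : ∀ j, K1 ≤ j → 0 < d j
  dle : ∀ j, K1 ≤ j → d j ≤ δ * j * Real.log j
  split : ∀ j x, K1 ≤ j → j ≤ x → d j = Dfin q p1 p2 j x + pr q p1 p2 j x * d x
  Plo : ∀ j, K1 ≤ j → κ / d j ≤ μ.real (CC j)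
  Phi : ∀ j, K1 ≤ j → μ.real (CC j) ≤ C / d j
  inter : ∀ j k, K1 ≤ j → j < k →
    μ.real (CC j ∩ CC k) ≤ C / Dfin q p1 p2 j k * μ.real (CC k)

lemma nonclose {K1 : ℕ} {δ C κ : ℝ} {d : ℕ → ℝ} (hC : 0 < C) (hκ : 0 < κ)
    (he : Est q p1 p2 μ K1 δ C κ d) {j k : ℕ} (hj : K1 ≤ j) (hjk : j < k)
    (hcl : d j / 2 ≤ Dfin q p1 p2 j k) :
    μ.real (CC j ∩ CC k) ≤ 2 * C / κ * μ.real (CC j) * μ.real (CC k) := by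
  refine (he.inter j k hj hjk).trans ?_
  have hd := he.dpos j hj
  refine mul_le_mul_of_nonneg_right ?_ measureReal_nonneg
  calc C / Dfin q p1 p2 j k ≤ C / (d j / 2) := by gcongr
    _ = 2 * C / κ * (κ / d j) := by field_simp
    _ ≤ _ := by gcongr; exact he.Plo j hj

lemma close_log (hy : Hyp q p1 p2) {K1 : ℕ} {δ C κ : ℝ} {d : ℕ → ℝ} (hδ : 0 < δ)
    (he : Est q p1 p2 μ K1 δ C κ d) {j k : ℕ} (hj : K1 ≤ j) (hjk : j < k)
    (hcl : Dfin q p1 p2 j k < d j / 2) : Real.log k ≤ Real.exp δ * Real.log j := by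
  have h3 := he.three
  have hd := he.dpos j hj
  have hpr : ∀ i ∈ Finset.Ico j k, d j / (2 * δ) * (1 / (i * Real.log i)) ≤ pr q p1 p2 j i := by
    intro i hi
    have hi := Finset.mem_Ico.1 hi
    have hdi := he.dpos i (by omega)
    have hli : 0 < Real.log i := Real.log_pos (by exact_mod_cast (by omega : 1 < i))
    have hip : (0 : ℝ) < i := by exact_mod_cast (by omega : 0 < i)
    have hmono : Dfin q p1 p2 j i ≤ Dfin q p1 p2 j k := by
      unfold Dfin
      exact Finset.sum_le_sum_of_subset_of_nonneg (Finset.Ico_subset_Ico_right hi.2.le)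
        fun l _ _ => (pr_pos hy (by omega) l).le
    have hs := he.split j i hj hi.1
    have h1 : d j / 2 ≤ pr q p1 p2 j i * (δ * i * Real.log i) :=
      le_trans (by linarith) (mul_le_mul_of_nonneg_left (he.dle i (by omega))
        (pr_pos hy (by omega) i).le)
    have e : d j / (2 * δ) * (1 / (i * Real.log i)) = d j / 2 / (δ * i * Real.log i) := by
      field_simp
    rw [e, div_le_iff₀ (by positivity)]
    exact h1
  have hsum := Finset.sum_le_sum hpr
  rw [← Finset.mul_sum] at hsum
  have h4 : d j / (2 * δ) * ∑ i ∈ Finset.Ico j k, 1 / (i * Real.log i) ≤ d j / (2 * δ) * δ := by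
    refine hsum.trans (le_trans hcl.le (le_of_eq ?_))
    field_simp
  have h5 := le_of_mul_le_mul_left h4 (by positivity)
  have h6 := (loglog_sum (by omega) hjk.le).trans h5
  have hlj : 0 < Real.log j := Real.log_pos (by exact_mod_cast (by omega : 1 < j))
  have hlk : 0 < Real.log k := Real.log_pos (by exact_mod_cast (by omega : 1 < k))
  rw [← Real.log_le_log_iff hlk (by positivity), Real.log_mul (Real.exp_pos _).ne' hlj.ne',
    Real.log_exp]
  linarith

lemma close_bound (hy : Hyp q p1 p2) (hr : Reg q p1 p2 K0 c) {K1 : ℕ} {δ C κ : ℝ} {d : ℕ → ℝ}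
    (hC : 0 < C) (hκ : 0 < κ) (hK : K0 ≤ K1)
    (he : Est q p1 p2 μ K1 δ C κ d) {j k : ℕ} (hj : K1 ≤ j) (hjk : j < k)
    (hcl : Dfin q p1 p2 j k < d j / 2) :
    μ.real (CC j ∩ CC k) ≤ 2 * C ^ 2 / κ * μ.real (CC j) * (1 / ((k : ℝ) - j)) := by
  have h3 := he.three
  have hd := he.dpos j hj
  have hdk := he.dpos k (by omega)
  have hkj : 0 < (k : ℝ) - j := by
    have : (j : ℝ) < k := by exact_mod_cast hjk
    linarith
  have hD := Dfin_pos hy (by omega) hjk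
  have h1 : ((k : ℝ) - j) * pr q p1 p2 j k ≤ Dfin q p1 p2 j k := by
    unfold Dfin
    have := Finset.card_nsmul_le_sum (Finset.Ico j k) (fun i => pr q p1 p2 j i) (pr q p1 p2 j k)
      (fun i hi => pr_anti hy hr (by omega) (Finset.mem_Ico.1 hi).1 (Finset.mem_Ico.1 hi).2.le)
    rw [Nat.card_Ico, nsmul_eq_mul, Nat.cast_sub hjk.le] at this
    exact this
  have h2 : d j / 2 ≤ pr q p1 p2 j k * d k := by
    have := he.split j k hj hjk.le
    linarith
  have h4 : ((k : ℝ) - j) * (d j / 2) ≤ Dfin q p1 p2 j k * d k := by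
    calc ((k : ℝ) - j) * (d j / 2) ≤ ((k : ℝ) - j) * (pr q p1 p2 j k * d k) := by gcongr
      _ = ((k : ℝ) - j) * pr q p1 p2 j k * d k := by ring
      _ ≤ _ := by gcongr
  calc μ.real (CC j ∩ CC k) ≤ C / Dfin q p1 p2 j k * μ.real (CC k) := he.inter j k hj hjk
    _ ≤ C / Dfin q p1 p2 j k * (C / d k) := by gcongr; exact he.Phi k (by omega)
    _ = C ^ 2 / (Dfin q p1 p2 j k * d k) := by field_simp
    _ ≤ C ^ 2 / (((k : ℝ) - j) * (d j / 2)) := by gcongr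
    _ = 2 * C ^ 2 / κ * (κ / d j) * (1 / ((k : ℝ) - j)) := by field_simp
    _ ≤ _ := by gcongr; exact he.Plo j hj

lemma second_moment (hy : Hyp q p1 p2) (hr : Reg q p1 p2 K0 c) {K1 : ℕ} {δ C κ : ℝ} {d : ℕ → ℝ}
    (hC : 0 < C) (hκ : 0 < κ) (hδ : 0 < δ) (hK : K0 ≤ K1)
    (he : Est q p1 p2 μ K1 δ C κ d) (F : Finset ℕ) (hF : ∀ k ∈ F, K1 ≤ k) {j : ℕ} (hj : j ∈ F) :
    ∑ k ∈ F with j < k, (1 / Real.log k) * μ.real (CC j ∩ CC k) ≤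
      μ.real (CC j) * (2 * C / κ * ∑ k ∈ F, (1 / Real.log k) * μ.real (CC k)
        + 2 * C ^ 2 / κ * (1 + Real.exp δ)) := by
  classical
  have h3 := he.three
  have hjK := hF j hj
  have hlog : ∀ k, K1 ≤ k → 1 ≤ Real.log k := by
    intro k hk
    rw [Real.le_log_iff_exp_le (by exact_mod_cast (by omega : 0 < k))]
    have : (3 : ℝ) ≤ k := by exact_mod_cast (by omega : 3 ≤ k)
    linarith [Real.exp_one_lt_d9]
  have hlj := hlog j hjK
  set G := F.filter (fun k => j < k ∧ Dfin q p1 p2 j k < d j / 2) with hG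
  have hGs : ∑ k ∈ G, (1 / Real.log k) * (1 / ((k : ℝ) - j)) ≤ 1 + Real.exp δ := by
    rcases G.eq_empty_or_nonempty with h | hne
    · rw [h, Finset.sum_empty]; positivity
    · set K := G.max' hne with hKm
      have hKG : K ∈ G := Finset.max'_mem _ hne
      rw [hG, Finset.mem_filter] at hKG
      have hcl := close_log hy hδ he hjK hKG.2.1 hKG.2.2
      have hKj := hKG.2.1
      calc ∑ k ∈ G, (1 / Real.log k) * (1 / ((k : ℝ) - j))
          ≤ ∑ k ∈ G, (1 / Real.log j) * (1 / ((k : ℝ) - j)) := by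
            refine Finset.sum_le_sum fun k hk => ?_
            rw [hG, Finset.mem_filter] at hk
            have : (j : ℝ) < k := by exact_mod_cast hk.2.1
            have : 0 < (k : ℝ) - j := by linarith
            have hjp : (0 : ℝ) < j := by exact_mod_cast (by omega : 0 < j)
            gcongr
        _ ≤ ∑ k ∈ Finset.Ioc j K, (1 / Real.log j) * (1 / ((k : ℝ) - j)) := by
            refine Finset.sum_le_sum_of_subset_of_nonneg (fun k hk => ?_) fun k hk _ => ?_
            · have := Finset.le_max' G k hk
              rw [hG, Finset.mem_filter] at hk
              exact Finset.mem_Ioc.2 ⟨hk.2.1, this⟩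
            · have : (j : ℝ) < k := by exact_mod_cast (Finset.mem_Ioc.1 hk).1
              have : 0 < (k : ℝ) - j := by linarith
              positivity
        _ = (1 / Real.log j) * ((harmonic (K - j) : ℚ) : ℝ) := by
            rw [← Finset.mul_sum, sum_inv_sub' j K hKj]
        _ ≤ (1 / Real.log j) * (1 + Real.log K) := by
            gcongr
            refine (harmonic_le_one_add_log _).trans ?_
            have : (0 : ℝ) < ((K - j : ℕ) : ℝ) := by exact_mod_cast (by omega : 0 < K - j)
            gcongr
            omega
        _ ≤ (1 / Real.log j) * (Real.log j + Real.exp δ * Real.log j) := by gcongr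
        _ = 1 + Real.exp δ := by field_simp
  have hpt : ∀ k ∈ F.filter (fun k => j < k), (1 / Real.log k) * μ.real (CC j ∩ CC k) ≤
      μ.real (CC j) * (2 * C / κ) * ((1 / Real.log k) * μ.real (CC k)) +
      μ.real (CC j) * (2 * C ^ 2 / κ) * (if Dfin q p1 p2 j k < d j / 2 then
        (1 / Real.log k) * (1 / ((k : ℝ) - j)) else 0) := by
    intro k hk
    rw [Finset.mem_filter] at hk
    have hlk := hlog k (hF k hk.1)
    by_cases hcl : Dfin q p1 p2 j k < d j / 2
    · rw [if_pos hcl]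
      have := close_bound hy hr hC hκ hK he hjK hk.2 hcl
      have h1 : (1 / Real.log k) * μ.real (CC j ∩ CC k) ≤
        (1 / Real.log k) * (2 * C ^ 2 / κ * μ.real (CC j) * (1 / ((k : ℝ) - j))) := by gcongr
      have h2 : 0 ≤ μ.real (CC j) * (2 * C / κ) * ((1 / Real.log k) * μ.real (CC k)) := by
        positivity
      linarith
    · rw [if_neg hcl, mul_zero, add_zero]
      have := nonclose hC hκ he hjK hk.2 (not_lt.1 hcl)
      have h1 : (1 / Real.log k) * μ.real (CC j ∩ CC k) ≤
        (1 / Real.log k) * (2 * C / κ * μ.real (CC j) * μ.real (CC k)) := by gcongr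
      linarith
  refine (Finset.sum_le_sum hpt).trans ?_
  rw [Finset.sum_add_distrib, ← Finset.mul_sum, ← Finset.mul_sum, ← Finset.sum_filter,
    Finset.filter_filter, mul_add, ← mul_assoc, ← mul_assoc]
  refine add_le_add ?_ ?_
  · refine mul_le_mul_of_nonneg_left ?_ (by positivity)
    refine Finset.sum_le_sum_of_subset_of_nonneg (Finset.filter_subset (fun k => j < k) F)
      fun k hk _ => ?_
    have := hlog k (hF k hk)
    positivity
  · gcongr

lemma exists_est (hy : Hyp q p1 p2) (hr : Reg q p1 p2 K0 c)
    (hμ : IsMarkovChain μ (transX q p1 p2) 2) {δ : ℝ} (hδ : 0 < δ)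
    (hD : ∀ᶠ n : ℕ in atTop, DX q p1 p2 n ≤ ENNReal.ofReal (δ * n * Real.log n)) :
    ∃ K1, K0 ≤ K1 ∧ (∀ j, K1 ≤ j → DX q p1 p2 j ≠ ⊤) ∧
      Est q p1 p2 μ K1 δ (1 / c) (1 / (2 * Real.exp 8)) (fun j => (DX q p1 p2 j).toReal) := by
  obtain ⟨n1, hn1⟩ := eventually_atTop.1 hD
  have hc := hr.cpos
  have h2 := hr.two
  have hK : ∀ j, max (max K0 3) n1 ≤ j → K0 ≤ j ∧ 3 ≤ j ∧ n1 ≤ j := by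
    intro j hj
    simp only [max_le_iff] at hj
    exact ⟨hj.1.1, hj.1.2, hj.2⟩
  have htop : ∀ j, max (max K0 3) n1 ≤ j → DX q p1 p2 j ≠ ⊤ := fun j hj =>
    ne_top_of_le_ne_top ENNReal.ofReal_ne_top (hn1 j (hK j hj).2.2)
  have hpos : ∀ j, max (max K0 3) n1 ≤ j → 0 < (DX q p1 p2 j).toReal := fun j hj =>
    ENNReal.toReal_pos (by unfold DX; simp) (htop j hj)
  have hof : ∀ j, max (max K0 3) n1 ≤ j → (DX q p1 p2 j)⁻¹
      = ENNReal.ofReal ((DX q p1 p2 j).toReal)⁻¹ := fun j hj => by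
    rw [ENNReal.ofReal_inv_of_pos (hpos j hj), ENNReal.ofReal_toReal (htop j hj)]
  refine ⟨max (max K0 3) n1, by simp, htop, ?_⟩
  constructor
  · simp
  · exact hpos
  · intro j hj
    have hjp : (1 : ℝ) ≤ j := by exact_mod_cast (by have := hK j hj; omega : 1 ≤ j)
    have := Real.log_nonneg hjp
    exact ENNReal.toReal_le_of_le_ofReal (by positivity) (hn1 j (hK j hj).2.2)
  · intro j x hj hx
    have h3 := hK j hj
    have hD0 := Dfin_nonneg hy (show 2 ≤ j by omega) x
    have hp0 := (pr_pos hy (show 2 ≤ j by omega) x).le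
    have := congrArg ENNReal.toReal (DX_split hy (show 2 ≤ j by omega) hx)
    rw [ENNReal.toReal_add ENNReal.ofReal_ne_top (ENNReal.mul_ne_top ENNReal.ofReal_ne_top
      (htop x (hj.trans hx))), ENNReal.toReal_mul, ENNReal.toReal_ofReal hD0,
      ENNReal.toReal_ofReal hp0] at this
    exact this
  · intro j hj
    have h1 := CC_lower hy hr hμ (hK j hj).1
    have h3 := hpos j hj
    rw [hof j hj, ← ENNReal.ofReal_mul (by positivity),
      ENNReal.ofReal_le_iff_le_toReal (measure_ne_top _ _)] at h1
    rw [div_eq_mul_inv (1 / (2 * Real.exp 8))]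
    exact h1
  · intro j hj
    have h1 := CC_upper hy hr hμ (hK j hj).1
    have h3 := hpos j hj
    rw [hof j hj, ← ENNReal.ofReal_mul (by positivity)] at h1
    rw [div_eq_mul_inv (1 / c)]
    exact ENNReal.toReal_le_of_le_ofReal (by positivity) h1
  · intro j k hj hjk
    have h3 := hK j hj
    have hDp := Dfin_pos hy (show 2 ≤ j by omega) hjk
    have h1 := AA_upper hy hr hμ h3.1 hjk
    have e : μ.real (CC j ∩ CC k) = μ.real (AA j k) * μ.real (CC k) := by
      unfold Measure.real
      rw [CC_inter hjk, indep_AA hy hμ j k (measurableSet_fut_CC le_rfl), ENNReal.toReal_mul]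
    rw [e]
    refine mul_le_mul_of_nonneg_right ?_ measureReal_nonneg
    have h4 := ENNReal.toReal_le_of_le_ofReal (by positivity) h1
    rw [div_eq_mul_one_div]
    exact h4

lemma exists_large {K1 : ℕ} {δ C κ : ℝ} (hκ : 0 < κ)
    (he : Est q p1 p2 μ K1 δ C κ (fun j => (DX q p1 p2 j).toReal))
    (htop : ∀ j, K1 ≤ j → DX q p1 p2 j ≠ ⊤)
    (hs : ∑' n, ff q p1 p2 (n + 2) = ⊤) (m : ℕ) (hm : K1 ≤ m) :
    ∃ M, 1 ≤ ∑ k ∈ Finset.Ico m M, (1 / Real.log k) * μ.real (CC k) := by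
  by_contra hcon
  push Not at hcon
  have h3 := he.three
  have hff : ∀ k, m ≤ k → ff q p1 p2 k ≤
      ENNReal.ofReal (1 / κ * ((1 / Real.log k) * μ.real (CC k))) := by
    intro k hk
    have hd := he.dpos k (by omega)
    have hl : 0 < Real.log k := Real.log_pos (by exact_mod_cast (by omega : 1 < k))
    have hP := he.Plo k (by omega)
    rw [ff_eq (by omega), ← ENNReal.ofReal_inv_of_pos hl]
    rw [← ENNReal.ofReal_toReal (htop k (by omega)), ← ENNReal.ofReal_inv_of_pos hd,
      ← ENNReal.ofReal_mul (by positivity)]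
    apply ENNReal.ofReal_le_ofReal
    calc ((DX q p1 p2 k).toReal)⁻¹ * (Real.log k)⁻¹
        = 1 / κ * (1 / Real.log k * (κ / (DX q p1 p2 k).toReal)) := by field_simp
      _ ≤ _ := by gcongr
  have hfin : ∀ k, 2 ≤ k → ff q p1 p2 k ≠ ⊤ := by
    intro k hk
    have hl : 0 < Real.log k := Real.log_pos (by exact_mod_cast (by omega : 1 < k))
    unfold ff
    rw [ENNReal.inv_ne_top]
    refine mul_ne_zero (by unfold DX; simp) (by simpa using hl)
  have htail : ∑' n, ff q p1 p2 (n + m + 2) ≤ ENNReal.ofReal (1 / κ) := by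
    rw [ENNReal.tsum_eq_iSup_nat]
    refine iSup_le fun N => ?_
    calc ∑ i ∈ Finset.range N, ff q p1 p2 (i + m + 2)
        = ∑ k ∈ Finset.Ico (m + 2) (N + (m + 2)), ff q p1 p2 k := by
          rw [Finset.sum_Ico_eq_sum_range]
          have e : N + (m + 2) - (m + 2) = N := by omega
          rw [e]
          exact Finset.sum_congr rfl fun i _ => by congr 1; omega
      _ ≤ ∑ k ∈ Finset.Ico m (N + (m + 2)), ff q p1 p2 k :=
          Finset.sum_le_sum_of_subset (Finset.Ico_subset_Ico_left (by omega))
      _ ≤ ∑ k ∈ Finset.Ico m (N + (m + 2)),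
          ENNReal.ofReal (1 / κ * ((1 / Real.log k) * μ.real (CC k))) :=
          Finset.sum_le_sum fun k hk => hff k (Finset.mem_Ico.1 hk).1
      _ = ENNReal.ofReal (∑ k ∈ Finset.Ico m (N + (m + 2)),
          1 / κ * ((1 / Real.log k) * μ.real (CC k))) := by
          rw [ENNReal.ofReal_sum_of_nonneg]
          intro k hk
          have := (Finset.mem_Ico.1 hk).1
          have hl : 0 < Real.log k := Real.log_pos (by exact_mod_cast (by omega : 1 < k))
          positivity
      _ ≤ ENNReal.ofReal (1 / κ) := by
          apply ENNReal.ofReal_le_ofReal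
          rw [← Finset.mul_sum]
          have := (hcon (N + (m + 2))).le
          have h0 : (0 : ℝ) ≤ 1 / κ := by positivity
          nlinarith
  have hsplit := ENNReal.summable.sum_add_tsum_nat_add' (f := fun n => ff q p1 p2 (n + 2)) (k := m)
  rw [hs] at hsplit
  refine (ENNReal.add_ne_top.2 ⟨?_, ?_⟩) hsplit
  · exact ENNReal.sum_ne_top.2 fun i _ => hfin _ (by omega)
  · exact ne_top_of_le_ne_top ENNReal.ofReal_ne_top htail

lemma part_two (hy : Hyp q p1 p2) (hr : Reg q p1 p2 K0 c)
    (hμ : IsMarkovChain μ (transX q p1 p2) 2) {δ : ℝ} (hδ : 0 < δ)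
    (hD : ∀ᶠ n : ℕ in atTop, DX q p1 p2 n ≤ ENNReal.ofReal (δ * n * Real.log n))
    (hs : ∑' n, ff q p1 p2 (n + 2) = ⊤) :
    ∀ᵐ ω ∂μ, {k : ℕ | ∃! n, ω n = k}.Infinite := by
  obtain ⟨K1, hK, htop, he⟩ := exists_est hy hr hμ hδ hD
  have hc := hr.cpos
  have h3 := he.three
  have hκ : (0 : ℝ) < 1 / (2 * Real.exp 8) := by positivity
  have hC : 0 < 1 / c := by positivity
  set κ : ℝ := 1 / (2 * Real.exp 8) with hκd
  set C : ℝ := 1 / c with hCd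
  set H1 : ℝ := 2 * C / κ with hH1
  set H2 : ℝ := 2 * C ^ 2 / κ * (1 + Real.exp δ) with hH2
  have h1p : 0 ≤ H1 := by positivity
  have h2p : 0 ≤ H2 := by positivity
  set H : ℝ := 2 * H1 + 2 * H2 + 1 with hH
  have hHp : 0 < H := by positivity
  have hlow : ∀ m, ENNReal.ofReal (1 / H) ≤ μ (⋃ k ∈ Set.Ici m, CC k) := by
    intro m
    obtain ⟨M, hM⟩ := exists_large hκ he htop hs (max m K1) (le_max_right _ _)
    have hFK : ∀ k ∈ Finset.Ico (max m K1) M, K1 ≤ k := fun k hk =>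
      (le_max_right m K1).trans (Finset.mem_Ico.1 hk).1
    have hlog : ∀ k ∈ Finset.Ico (max m K1) M, 1 ≤ Real.log k := by
      intro k hk
      have hk := hFK k hk
      rw [Real.le_log_iff_exp_le (by exact_mod_cast (by omega : 0 < k))]
      have : (3 : ℝ) ≤ k := by exact_mod_cast (by omega : 3 ≤ k)
      linarith [Real.exp_one_lt_d9]
    have := kochen_stone (μ := μ) (Finset.Ico (max m K1) M) (fun k => 1 / Real.log k)
      (fun k hk => by have := hlog k hk; positivity)
      (fun k hk => by
        have := hlog k hk
        rw [div_le_one (by linarith)]; exact this)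
      H1 H2 h1p h2p hM
      (fun j hj => second_moment hy hr hC hκ hδ hK he _ hFK hj)
    have h5 : 1 / H ≤ μ.real (⋃ k ∈ Finset.Ico (max m K1) M, CC k) := by
      rw [div_le_iff₀ hHp, mul_comm]; exact this
    unfold Measure.real at h5
    rw [← ENNReal.ofReal_le_iff_le_toReal (measure_ne_top _ _)] at h5
    refine h5.trans (measure_mono ?_)
    refine Set.iUnion₂_mono' fun k hk => ⟨k, ?_, subset_rfl⟩
    exact (le_max_left m K1).trans (Finset.mem_Ico.1 hk).1
  have hset : {ω | ∀ N, ∃ k ≥ N, ω ∈ CC k} = ⋂ m, ⋃ k ∈ Set.Ici m, CC k := by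
    ext ω; simp
  have hmeas : ∀ m, MeasurableSet (⋃ k ∈ Set.Ici m, CC k) := fun m =>
    MeasurableSet.biUnion (Set.to_countable _) fun k _ => measurableSet_CC k
  have htend := tendsto_measure_iInter_atTop (μ := μ) (s := fun m => ⋃ k ∈ Set.Ici m, CC k)
    (fun m => (hmeas m).nullMeasurableSet)
    (fun m n hmn => Set.biUnion_subset_biUnion_left (Set.Ici_subset_Ici.2 hmn))
    ⟨0, measure_ne_top _ _⟩
  have hpos : ENNReal.ofReal (1 / H) ≤ μ {ω | ∀ N, ∃ k ≥ N, ω ∈ CC k} := by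
    rw [hset]
    exact ge_of_tendsto' htend hlow
  have hone : μ {ω | ∀ N, ∃ k ≥ N, ω ∈ CC k} = 1 := by
    rcases tail_zero_one hy hμ with h | h
    · rw [h] at hpos
      have : 0 < ENNReal.ofReal (1 / H) := by simp [hHp]
      exact absurd hpos (not_le.2 this)
    · exact h
  have hmS : MeasurableSet {ω | ∀ N, ∃ k ≥ N, ω ∈ CC k} := by
    rw [hset]; exact MeasurableSet.iInter hmeas
  have hae : ∀ᵐ ω ∂μ, ∀ N, ∃ k ≥ N, ω ∈ CC k := (prob_compl_eq_zero_iff hmS).2 hone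
  filter_upwards [hae, ae_good hy hμ] with ω h1 h2
  refine Set.infinite_of_not_bddAbove ?_
  rintro ⟨B, hB⟩
  obtain ⟨k, hk, hkC⟩ := h1 (B + 3)
  have := hB (cut_of_CC h2 (by omega) hkC)
  omega


end Aux

theorem cutpoints_X_finite_or_infinite
    (q p1 p2 : ℕ → ℝ)
    (hq : ∀ k, 2 ≤ k → 0 < q k) (hp1 : ∀ k, 2 ≤ k → 0 ≤ p1 k)
    (hp2 : ∀ k, 2 ≤ k → 0 < p2 k)
    (hsum : ∀ k, 2 ≤ k → q k + p1 k + p2 k = 1)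
    (μ : Measure (ℕ → ℕ)) [IsProbabilityMeasure μ]
    (hμ : IsMarkovChain μ (transX q p1 p2) 2)
    (a b : ℝ) (ha : 0 < a) (hb : 0 < b)
    (hCa : Tendsto (fun k => (p1 k + p2 k) / q k) atTop (𝓝 a))
    (hCb : Tendsto (fun k => p2 k / q k) atTop (𝓝 b))
    (hab : a + b = 1)
    (N₀ : ℕ) (hN₀ : 0 < N₀)
    (hmono : ∀ k l, N₀ ≤ k → k ≤ l → rho q p1 p2 k ≤ rho q p1 p2 l) :
    ((∑' n : ℕ,
        (DX q p1 p2 (n + 2) * ENNReal.ofReal (Real.log ((n : ℝ) + 2)))⁻¹) ≠ ⊤ →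
      μ {ω | {k : ℕ | ∃! n, ω n = k}.Finite} = 1) ∧
    ((∃ δ : ℝ, 0 < δ ∧ ∀ᶠ n : ℕ in atTop,
        DX q p1 p2 n ≤ ENNReal.ofReal (δ * n * Real.log n)) →
      (∑' n : ℕ,
        (DX q p1 p2 (n + 2) * ENNReal.ofReal (Real.log ((n : ℝ) + 2)))⁻¹) = ⊤ →
      μ {ω | {k : ℕ | ∃! n, ω n = k}.Infinite} = 1) := by
  have hy : Hyp q p1 p2 := ⟨hq, hp1, hp2, hsum⟩
  obtain ⟨K0, c, hr⟩ := exists_reg a b ha hb hCa hCb hab N₀ hmono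
  have hff : (∑' n : ℕ,
      (DX q p1 p2 (n + 2) * ENNReal.ofReal (Real.log ((n : ℝ) + 2)))⁻¹)
      = ∑' n, ff q p1 p2 (n + 2) := by
    refine tsum_congr fun n => ?_
    unfold ff
    push_cast
    rfl
  rw [hff]
  refine ⟨fun h => ?_, ?_⟩
  · have := part_one hy hr hμ h
    exact (measure_congr (eventuallyEq_univ.2 this)).trans measure_univ
  · rintro ⟨δ, hδ, hD⟩ h
    have := part_two hy hr hμ hδ hD h
    exact (measure_congr (eventuallyEq_univ.2 this)).trans measure_univ

end
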